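/- arXiv:1706.03139 — 10 statements merged into one kernel-verified Lean document; each statement's English description precedes it below -/
import Mathlib

section
/- For H ∈ (1/2, 1) and a > 0, the fOU moving-average kernel admits the closed-form representation K(t) = (1/Γ(H−1/2)) · ∫₀^t (t−s)^{H−3/2} e^{−a s} ds for every t > 0. -/
open Real MeasureTheory Set Filter

/-- The fOU moving-average kernel
`K(t) = (1/Γ(H+1/2)) · (t^{H−1/2} − a ∫₀^t (t−s)^{H−1/2} e^{−a s} ds)`. -/
noncomputable def fouKernel (H a t : ℝ) : ℝ :=
  (1 / Real.Gamma (H + 1 / 2)) *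
    (t ^ (H - 1 / 2) - a * ∫ s in (0 : ℝ)..t, (t - s) ^ (H - 1 / 2) * Real.exp (-a * s))

/-- Integration by parts for the convolution of a power `p > 0` with an exponential. -/
theorem rpow_sub_mul_integral_sub_rpow_mul_exp {p t : ℝ} (a : ℝ) (hp : 0 < p) (ht : 0 < t) :
    t ^ p - a * ∫ s in (0 : ℝ)..t, (t - s) ^ p * Real.exp (-a * s) =
      p * ∫ s in (0 : ℝ)..t, (t - s) ^ (p - 1) * Real.exp (-a * s) := by
  have hint : IntervalIntegrable (fun s : ℝ => (t - s) ^ (p - 1)) volume 0 t := by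
    have h := (intervalIntegral.intervalIntegrable_rpow' (a := 0) (b := t)
      (r := p - 1) (by linarith)).comp_sub_left t
    simpa using h.symm
  have hparts := intervalIntegral.integral_mul_deriv_eq_deriv_mul_of_hasDerivAt
    (a := 0) (b := t) (u := fun s : ℝ => (t - s) ^ p) (v := fun s => Real.exp (-a * s))
    (u' := fun s => -p * (t - s) ^ (p - 1)) (v' := fun s => -a * Real.exp (-a * s))
    (Continuous.continuousOn (Continuous.rpow_const (by fun_prop) fun _ => Or.inr hp.le))
    (by fun_prop)
    (fun s hs => by
      rw [min_eq_left ht.le, max_eq_right ht.le] at hs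
      have h := ((hasDerivAt_id' s).const_sub t).rpow_const (p := p)
        (Or.inl (sub_pos.2 hs.2).ne')
      exact h.congr_deriv (by ring))
    (fun s _ => by
      have h := ((hasDerivAt_id' s).const_mul (-a)).exp
      exact h.congr_deriv (by ring))
    (hint.const_mul _)
    (Continuous.intervalIntegrable (by fun_prop) _ _)
  simp only [mul_left_comm _ (-a), mul_assoc (-p), intervalIntegral.integral_const_mul,
    sub_self, sub_zero, Real.zero_rpow hp.ne', zero_mul, mul_zero, Real.exp_zero,
    mul_one] at hparts
  linarith

/-- For `H ∈ (1/2,1)` and `a > 0`, the fOU kernel admits the closed-form representation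
`K(t) = (1/Γ(H−1/2)) · ∫₀^t (t−s)^{H−3/2} e^{−a s} ds` for every `t > 0`. -/
theorem fouKernel_eq_integral (H a : ℝ) (hH : 1 / 2 < H) (hH1 : H < 1) (ha : 0 < a) :
    ∀ t : ℝ, 0 < t →
      fouKernel H a t =
        (1 / Real.Gamma (H - 1 / 2)) *
          ∫ s in (0 : ℝ)..t, (t - s) ^ (H - 3 / 2) * Real.exp (-a * s) := by
  intro t ht
  have hp : 0 < H - 1 / 2 := by linarith
  have hΓ : Real.Gamma (H + 1 / 2) = (H - 1 / 2) * Real.Gamma (H - 1 / 2) := by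
    rw [← Real.Gamma_add_one hp.ne']
    congr 1
    ring
  have hexp : H - 3 / 2 = H - 1 / 2 - 1 := by ring
  have hΓ_ne := (Real.Gamma_pos_of_pos hp).ne'
  rw [fouKernel, rpow_sub_mul_integral_sub_rpow_mul_exp a hp ht, hΓ, hexp]
  generalize H - 1 / 2 = p at *
  generalize (∫ s in (0 : ℝ)..t, (t - s) ^ (p - 1) * Real.exp (-a * s)) = J
  field_simp
end

section
/- For H ∈ (1/2, 1) and a > 0, the fOU moving-average kernel is strictly positive: K(t) > 0 for every t > 0. -/
open Real MeasureTheory Set Filter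

/-- For `H ∈ (1/2,1)` and `a > 0`, the fOU kernel is strictly positive: `K(t) > 0` for `t > 0`. -/
theorem fouKernel_pos (H a : ℝ) (hH : 1 / 2 < H) (hH1 : H < 1) (ha : 0 < a) :
    ∀ t : ℝ, 0 < t → 0 < fouKernel H a t := by
  intro t ht
  have hp : 0 ≤ H - 1 / 2 := by linarith
  have hexp : ∫ s in (0 : ℝ)..t, Real.exp (-a * s) = (1 - Real.exp (-a * t)) / a := by
    have hderiv : ∀ s ∈ uIcc 0 t,
        HasDerivAt (fun x : ℝ => -Real.exp (-a * x) / a) (Real.exp (-a * s)) s := by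
      intro s _
      have h := (((hasDerivAt_id s).const_mul (-a)).exp.neg).div_const a
      refine h.congr_deriv ?_
      simp only [id]
      field_simp
    rw [intervalIntegral.integral_eq_sub_of_hasDerivAt hderiv
      (Continuous.intervalIntegrable (by fun_prop) _ _)]
    simp only [mul_zero, Real.exp_zero]
    ring
  have hcont : Continuous fun s : ℝ => (t - s) ^ (H - 1 / 2) * Real.exp (-a * s) :=
    ((continuous_const.sub continuous_id).rpow_const fun _ => Or.inr hp).mul (by fun_prop)
  have hle : ∫ s in (0 : ℝ)..t, (t - s) ^ (H - 1 / 2) * Real.exp (-a * s) ≤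
      ∫ s in (0 : ℝ)..t, t ^ (H - 1 / 2) * Real.exp (-a * s) := by
    refine intervalIntegral.integral_mono_on ht.le (hcont.intervalIntegrable _ _)
      (Continuous.intervalIntegrable (by fun_prop) _ _) fun s hs => ?_
    exact mul_le_mul_of_nonneg_right
      (Real.rpow_le_rpow (by linarith [hs.2]) (by linarith [hs.1]) hp) (Real.exp_pos _).le
  rw [intervalIntegral.integral_const_mul, hexp] at hle
  have hmul := mul_le_mul_of_nonneg_left hle ha.le
  have hcancel : a * (t ^ (H - 1 / 2) * ((1 - Real.exp (-a * t)) / a)) =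
      t ^ (H - 1 / 2) - t ^ (H - 1 / 2) * Real.exp (-a * t) := by
    field_simp
  have hpos : 0 < t ^ (H - 1 / 2) * Real.exp (-a * t) :=
    mul_pos (Real.rpow_pos_of_pos ht _) (Real.exp_pos _)
  exact mul_pos (one_div_pos.mpr (Real.Gamma_pos_of_pos (by linarith))) (by linarith)
end

section
/- For H ∈ (1/2, 1), a > 0 and every t > 0, the fOU moving-average kernel satisfies the two-sided short-time bound 0 ≤ t^{H−1/2}/Γ(H+1/2) − K(t) ≤ a · t^{H+1/2}/Γ(H+3/2); in particular K(t) behaves like t^{H−1/2}/Γ(H+1/2) as t → 0⁺. -/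
open Real MeasureTheory Set Filter

/-- A Riemann–Liouville integral of the decaying exponential is nonnegative. -/
theorem integral_sub_rpow_mul_exp_nonneg (p a : ℝ) {t : ℝ} (ht : 0 ≤ t) :
    0 ≤ ∫ s in (0 : ℝ)..t, (t - s) ^ p * Real.exp (-a * s) := by
  refine intervalIntegral.integral_nonneg ht fun s hs => ?_
  have : 0 ≤ t - s := sub_nonneg.2 hs.2
  positivity

/-- A Riemann–Liouville integral of the decaying exponential is at most that of `1`. -/
theorem integral_sub_rpow_mul_exp_le {p a t : ℝ} (hp : 0 ≤ p) (ha : 0 ≤ a) (ht : 0 ≤ t) :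
    ∫ s in (0 : ℝ)..t, (t - s) ^ p * Real.exp (-a * s) ≤ t ^ (p + 1) / (p + 1) := by
  have hpow : Continuous fun s : ℝ => (t - s) ^ p :=
    (continuous_const.sub continuous_id).rpow_const fun _ => Or.inr hp
  have hexp : Continuous fun s : ℝ => Real.exp (-a * s) := by fun_prop
  calc ∫ s in (0 : ℝ)..t, (t - s) ^ p * Real.exp (-a * s)
      ≤ ∫ s in (0 : ℝ)..t, (t - s) ^ p := by
        refine intervalIntegral.integral_mono_on ht
          ((hpow.mul hexp).intervalIntegrable _ _) (hpow.intervalIntegrable _ _) fun s hs => ?_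
        refine mul_le_of_le_one_right (Real.rpow_nonneg (sub_nonneg.2 hs.2) p) ?_
        exact Real.exp_le_one_iff.2 (by nlinarith [mul_nonneg ha hs.1])
    _ = t ^ (p + 1) / (p + 1) := by
        rw [intervalIntegral.integral_comp_sub_left (fun x : ℝ => x ^ p) t, sub_self, sub_zero,
          integral_rpow (Or.inl (by linarith)), Real.zero_rpow (by linarith), sub_zero]

/-- For `H ∈ (1/2,1)`, `a > 0`, `t > 0`, the two-sided short-time bound
`0 ≤ t^{H−1/2}/Γ(H+1/2) − K(t) ≤ a·t^{H+1/2}/Γ(H+3/2)`. -/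
theorem fouKernel_short_time_bound (H a : ℝ) (hH : 1 / 2 < H) (hH1 : H < 1) (ha : 0 < a) :
    ∀ t : ℝ, 0 < t →
      0 ≤ t ^ (H - 1 / 2) / Real.Gamma (H + 1 / 2) - fouKernel H a t ∧
        t ^ (H - 1 / 2) / Real.Gamma (H + 1 / 2) - fouKernel H a t ≤
          a * t ^ (H + 1 / 2) / Real.Gamma (H + 3 / 2) := by
  intro t ht
  have hG : 0 < Real.Gamma (H + 1 / 2) := Real.Gamma_pos_of_pos (by linarith)
  have hGrec : Real.Gamma (H + 3 / 2) = (H + 1 / 2) * Real.Gamma (H + 1 / 2) := by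
    rw [← Real.Gamma_add_one (by linarith)]
    ring_nf
  have hnonneg := integral_sub_rpow_mul_exp_nonneg (H - 1 / 2) a ht.le
  have hle := integral_sub_rpow_mul_exp_le (p := H - 1 / 2) (by linarith) ha.le ht.le
  rw [show H - 1 / 2 + 1 = H + 1 / 2 by ring] at hle
  have hdiff : t ^ (H - 1 / 2) / Real.Gamma (H + 1 / 2) - fouKernel H a t =
      a / Real.Gamma (H + 1 / 2) *
        ∫ s in (0 : ℝ)..t, (t - s) ^ (H - 1 / 2) * Real.exp (-a * s) := by
    rw [fouKernel]
    ring
  rw [hdiff]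
  refine ⟨by positivity, (mul_le_mul_of_nonneg_left hle (by positivity)).trans_eq ?_⟩
  rw [hGrec, div_mul_div_comm, mul_comm (Real.Gamma _)]
end

section
/- For H ∈ (1/2, 1) and a > 0, the fOU moving-average kernel has the long-time power-law asymptotics lim_{t → ∞} t^{3/2−H} · K(t) = 1/(a · Γ(H−1/2)). -/
open Real MeasureTheory Set Filter

/-- The derivative quotient rule for limits at `+∞` for a denominator tending to `+∞`. -/
theorem tendsto_div_atTop_of_hasDerivAt {F G F' G' : ℝ → ℝ} {L : ℝ}
    (hF : ∀ᶠ t in atTop, HasDerivAt F (F' t) t)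
    (hG : ∀ᶠ t in atTop, HasDerivAt G (G' t) t)
    (hpos : ∀ᶠ t in atTop, 0 < G' t)
    (hlim : Tendsto (fun t => F' t / G' t) atTop (nhds L))
    (hinf : Tendsto G atTop atTop) :
    Tendsto (fun t => F t / G t) atTop (nhds L) := by
  rw [Metric.tendsto_nhds]
  intro ε hε
  have h := (Metric.tendsto_nhds.1 hlim (ε / 3) (by positivity))
  obtain ⟨T, hT⟩ := eventually_atTop.1 (hF.and (hG.and (hpos.and h)))
  have mono (σ : ℝ) (hσ : |σ| = 1) :
      MonotoneOn (fun t => ε / 3 * G t + σ * (F t - L * G t)) (Ici T) := by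
    have hd : ∀ t ∈ Ici T, HasDerivAt (fun t => ε / 3 * G t + σ * (F t - L * G t))
        (ε / 3 * G' t + σ * (F' t - L * G' t)) t := fun t ht =>
      ((hT t ht).2.1.const_mul _).add
        (((hT t ht).1.sub ((hT t ht).2.1.const_mul L)).const_mul σ)
    apply monotoneOn_of_deriv_nonneg (convex_Ici T)
    · exact fun t ht => (hd t ht).continuousAt.continuousWithinAt
    · exact fun t ht => (hd t (interior_subset ht)).differentiableAt.differentiableWithinAt
    · intro t ht
      have ht' := interior_subset ht
      rw [(hd t ht').deriv]
      obtain ⟨-, -, hp, hl⟩ := hT t ht'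
      rw [Real.dist_eq] at hl
      have e : F' t - L * G' t = (F' t / G' t - L) * G' t := by field_simp
      have hb : |σ * (F' t - L * G' t)| ≤ ε / 3 * G' t := by
        rw [e, abs_mul, hσ, one_mul, abs_mul, abs_of_pos hp]
        gcongr
      linarith [neg_abs_le (σ * (F' t - L * G' t))]
  set C := |ε / 3 * G T| + |F T - L * G T| with hC
  filter_upwards [eventually_ge_atTop T, hinf.eventually_gt_atTop 0,
    hinf.eventually_gt_atTop (3 * C / ε)] with t ht hp hCt
  have h1 := mono 1 (by simp) self_mem_Ici ht ht
  have h2 := mono (-1) (by simp) self_mem_Ici ht ht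
  have hC' : C < ε / 3 * G t := by
    rw [div_lt_iff₀ hε] at hCt
    linarith
  simp only at h1 h2
  have e : F t / G t - L = (F t - L * G t) / G t := by field_simp
  rw [Real.dist_eq, e, abs_div, abs_of_pos hp, div_lt_iff₀ hp, abs_lt]
  have b1 := neg_abs_le (ε / 3 * G T)
  have b2 := neg_abs_le (F T - L * G T)
  have b3 := le_abs_self (F T - L * G T)
  have : 0 < ε * G t := by positivity
  constructor <;> linarith

/-- Reflecting the convolution variable takes the factor `e^{-at}` out of the integral. -/
theorem integral_sub_rpow_mul_exp_neg (ν a t : ℝ) :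
    ∫ s in (0 : ℝ)..t, (t - s) ^ ν * Real.exp (-a * s) =
      Real.exp (-(a * t)) * ∫ u in (0 : ℝ)..t, u ^ ν * Real.exp (a * u) := by
  have h := intervalIntegral.integral_comp_sub_left (a := 0) (b := t)
    (fun u : ℝ => u ^ ν * Real.exp (-a * (t - u))) t
  simp only [sub_sub_cancel, sub_zero, sub_self] at h
  rw [h, ← intervalIntegral.integral_const_mul]
  congr 1
  ext u
  rw [mul_left_comm, ← Real.exp_add]
  ring_nf

/-- For `H ∈ (1/2,1)` and `a > 0`, the long-time power-law asymptotics
`lim_{t → ∞} t^{3/2−H}·K(t) = 1/(a·Γ(H−1/2))`. -/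
theorem fouKernel_long_time_asymptotics (H a : ℝ) (hH : 1 / 2 < H) (hH1 : H < 1) (ha : 0 < a) :
    Tendsto (fun t : ℝ => t ^ (3 / 2 - H) * fouKernel H a t) atTop
      (nhds (1 / (a * Real.Gamma (H - 1 / 2)))) := by
  obtain ⟨ν, rfl⟩ : ∃ ν, H = ν + 1 / 2 := ⟨H - 1 / 2, by ring⟩
  have hν : 0 < ν := by linarith
  have hcont : Continuous fun u : ℝ => u ^ ν * Real.exp (a * u) :=
    (Real.continuous_rpow_const hν.le).mul (by fun_prop)
  have hexp (t : ℝ) : HasDerivAt (fun t => Real.exp (a * t)) (Real.exp (a * t) * a) t := by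
    simpa using ((hasDerivAt_id t).const_mul a).exp
  have key : Tendsto (fun t : ℝ =>
      (t ^ ν * Real.exp (a * t) - a * ∫ u in (0 : ℝ)..t, u ^ ν * Real.exp (a * u)) /
        (t ^ (ν - 1) * Real.exp (a * t))) atTop (nhds (ν / a)) := by
    have hden : Tendsto (fun t : ℝ => a + (ν - 1) * t⁻¹) atTop (nhds a) := by
      simpa using (tendsto_inv_atTop_zero.const_mul (ν - 1)).const_add a
    apply tendsto_div_atTop_of_hasDerivAt
      (F' := fun t => ν * (t ^ (ν - 1) * Real.exp (a * t)))
      (G' := fun t => (a + (ν - 1) * t⁻¹) * (t ^ (ν - 1) * Real.exp (a * t)))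
    · filter_upwards [eventually_gt_atTop 0] with t ht
      refine (((Real.hasDerivAt_rpow_const (Or.inl ht.ne')).mul (hexp t)).sub
        ((hcont.integral_hasStrictDerivAt 0 t).hasDerivAt.const_mul a)).congr_deriv ?_
      ring
    · filter_upwards [eventually_gt_atTop 0] with t ht
      refine ((Real.hasDerivAt_rpow_const (Or.inl ht.ne')).mul (hexp t)).congr_deriv ?_
      rw [Real.rpow_sub_one ht.ne' (ν - 1)]
      ring
    · filter_upwards [eventually_gt_atTop 0, hden.eventually_const_lt ha] with t ht h
      positivity
    · refine (tendsto_const_nhds.div hden ha.ne').congr' ?_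
      filter_upwards [eventually_gt_atTop 0] with t ht
      have : t ^ (ν - 1) * Real.exp (a * t) ≠ 0 := by positivity
      exact (mul_div_mul_right _ _ this).symm
    · refine (tendsto_exp_mul_div_rpow_atTop (1 - ν) a ha).congr' ?_
      filter_upwards [eventually_gt_atTop 0] with t ht
      rw [← neg_sub, Real.rpow_neg ht.le, div_eq_mul_inv, inv_inv, mul_comm]
  have hΓ : Real.Gamma ν ≠ 0 := (Real.Gamma_pos_of_pos hν).ne'
  have hlim := key.const_mul (1 / Real.Gamma (ν + 1))
  have e : 1 / Real.Gamma (ν + 1) * (ν / a) = 1 / (a * Real.Gamma (ν + 1 / 2 - 1 / 2)) := by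
    rw [Real.Gamma_add_one hν.ne', add_sub_cancel_right]
    field_simp
  rw [e] at hlim
  refine hlim.congr' ?_
  filter_upwards [eventually_gt_atTop 0] with t ht
  have e1 : ν + 1 / 2 + 1 / 2 = ν + 1 := by ring
  have e2 : (3 / 2 - (ν + 1 / 2) : ℝ) = -(ν - 1) := by ring
  rw [fouKernel, e1, e2, add_sub_cancel_right, integral_sub_rpow_mul_exp_neg,
    Real.rpow_neg ht.le, Real.exp_neg]
  have : t ^ (ν - 1) ≠ 0 := by positivity
  field_simp
end

section
/- For H ∈ (1/2, 1) and a > 0, the function t ↦ K(t) − t^{H−3/2}/(a · Γ(H−1/2)) is Lebesgue integrable on (0, ∞). -/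
open Real MeasureTheory Set Filter

/-- The primitive `∫₀^t u^α e^{a u} du` appearing in the exponentially weighted power law. -/
noncomputable def expPowPrimitive (α a t : ℝ) : ℝ :=
  ∫ u in (0 : ℝ)..t, u ^ α * Real.exp (a * u)

/-- `e^{a t}` times the unnormalized difference between the kernel and its power-law tail. -/
noncomputable def weightedRemainder (α a t : ℝ) : ℝ :=
  Real.exp (a * t) * t ^ α - a * expPowPrimitive α a t
    - α / a * (Real.exp (a * t) * t ^ (α - 1))

lemma hasDerivAt_expPowPrimitive {α : ℝ} (hα : 0 < α) (a t : ℝ) :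
    HasDerivAt (expPowPrimitive α a) (t ^ α * Real.exp (a * t)) t := by
  have hc : Continuous fun u : ℝ => u ^ α * Real.exp (a * u) :=
    (Real.continuous_rpow_const hα.le).mul (by fun_prop)
  exact hc.integral_hasStrictDerivAt 0 t |>.hasDerivAt

lemma hasDerivAt_exp_mul_rpow (a p : ℝ) {t : ℝ} (ht : 0 < t) :
    HasDerivAt (fun x : ℝ => Real.exp (a * x) * x ^ p)
      (Real.exp (a * t) * a * t ^ p + Real.exp (a * t) * (p * t ^ (p - 1))) t := by
  have h : HasDerivAt (fun x : ℝ => Real.exp (a * x)) (Real.exp (a * t) * a) t := by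
    simpa using ((hasDerivAt_id t).const_mul a).exp
  exact h.mul (Real.hasDerivAt_rpow_const (Or.inl ht.ne'))

lemma hasDerivAt_weightedRemainder {α a : ℝ} (hα : 0 < α) (ha : a ≠ 0) {t : ℝ} (ht : 0 < t) :
    HasDerivAt (weightedRemainder α a)
      (α * (1 - α) / a * (Real.exp (a * t) * t ^ (α - 2))) t := by
  have h := ((hasDerivAt_exp_mul_rpow a α ht).sub
    ((hasDerivAt_expPowPrimitive hα a t).const_mul a)).sub
    ((hasDerivAt_exp_mul_rpow a (α - 1) ht).const_mul (α / a))
  refine h.congr_deriv ?_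
  rw [show α - 1 - 1 = α - 2 by ring]
  field_simp
  ring

/-- Two-sided bound on the remainder for large times. -/
lemma exists_abs_exp_mul_weightedRemainder_le {α a : ℝ} (hα : 0 < α) (hα1 : α < 1) (ha : 0 < a) :
    ∃ t₀ > 0, ∃ M C : ℝ, ∀ t ≥ t₀,
      |Real.exp (-a * t) * weightedRemainder α a t| ≤ M * t ^ (α - 2) + C * Real.exp (-a * t) := by
  set b : ℝ := α * (1 - α) / a with hb
  have hb0 : 0 < b := by
    have : 0 < 1 - α := by linarith
    positivity
  set t₀ : ℝ := 2 * (2 - α) / a with ht₀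
  have ht₀0 : 0 < t₀ := by
    have : 0 < 2 - α := by linarith
    positivity
  set M : ℝ := 2 * b / a with hM
  have hM0 : 0 < M := by positivity
  have hmono : MonotoneOn (weightedRemainder α a) (Ici t₀) := by
    refine monotoneOn_of_hasDerivWithinAt_nonneg (convex_Ici t₀)
      (fun t ht => (hasDerivAt_weightedRemainder hα ha.ne'
        (ht₀0.trans_le ht)).continuousAt.continuousWithinAt)
      (fun t ht => (hasDerivAt_weightedRemainder hα ha.ne'
        (ht₀0.trans_le (interior_subset ht))).hasDerivWithinAt) (fun t ht => ?_)
    have : 0 < t := ht₀0.trans_le (interior_subset ht)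
    rw [← hb]
    positivity
  have hderiv : ∀ t : ℝ, 0 < t → HasDerivAt
      (fun x => weightedRemainder α a x - M * (Real.exp (a * x) * x ^ (α - 2))) _ t :=
    fun t ht => (hasDerivAt_weightedRemainder hα ha.ne' ht).sub
      ((hasDerivAt_exp_mul_rpow a (α - 2) ht).const_mul M)
  have hanti : AntitoneOn
      (fun x => weightedRemainder α a x - M * (Real.exp (a * x) * x ^ (α - 2))) (Ici t₀) := by
    refine antitoneOn_of_hasDerivWithinAt_nonpos (convex_Ici t₀)
      (fun t ht => (hderiv t (ht₀0.trans_le ht)).continuousAt.continuousWithinAt)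
      (fun t ht => (hderiv t (ht₀0.trans_le (interior_subset ht))).hasDerivWithinAt)
      (fun t ht => ?_)
    have htt : t₀ ≤ t := interior_subset ht
    have ht0 : 0 < t := ht₀0.trans_le htt
    have hpow : t ^ (α - 2) = t * t ^ (α - 2 - 1) := by
      rw [Real.rpow_sub_one ht0.ne']
      field_simp
    have key : 2 * (2 - α) ≤ a * t := by
      rw [ht₀, div_le_iff₀ ha] at htt
      linarith
    have hp : 0 < Real.exp (a * t) * t ^ (α - 2 - 1) := by positivity
    have hMa : M * a = 2 * b := by rw [hM]; field_simp
    have hfac : M * (2 - α) ≤ b * t := by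
      rw [hM, div_mul_eq_mul_div, div_le_iff₀ ha]
      nlinarith
    rw [← hb, hpow]
    have heq : b * (Real.exp (a * t) * (t * t ^ (α - 2 - 1))) -
        M * (Real.exp (a * t) * a * (t * t ^ (α - 2 - 1)) +
          Real.exp (a * t) * ((α - 2) * t ^ (α - 2 - 1)))
        = (Real.exp (a * t) * t ^ (α - 2 - 1)) * (M * (2 - α) - b * t) := by
      linear_combination (-(Real.exp (a * t) * t ^ (α - 2 - 1) * t)) * hMa
    rw [heq]
    exact mul_nonpos_of_nonneg_of_nonpos hp.le (by linarith)
  refine ⟨t₀, ht₀0, M, |weightedRemainder α a t₀|, fun t ht => ?_⟩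
  have ht0 : 0 < t := ht₀0.trans_le ht
  have h1 := hmono self_mem_Ici ht ht
  have h2 := hanti self_mem_Ici ht ht
  have h3 : 0 < M * (Real.exp (a * t₀) * t₀ ^ (α - 2)) := by positivity
  have h4 : 0 < M * (Real.exp (a * t) * t ^ (α - 2)) := by positivity
  have h5 : |weightedRemainder α a t|
      ≤ M * (Real.exp (a * t) * t ^ (α - 2)) + |weightedRemainder α a t₀| := by
    have h6 := neg_abs_le (weightedRemainder α a t₀)
    have h7 := le_abs_self (weightedRemainder α a t₀)
    simp only at h2
    rw [abs_le]
    constructor <;> linarith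
  have hexp : Real.exp (-a * t) * Real.exp (a * t) = 1 := by
    rw [← Real.exp_add]; simp
  rw [abs_mul, abs_of_pos (Real.exp_pos _)]
  calc _ ≤ Real.exp (-a * t) *
        (M * (Real.exp (a * t) * t ^ (α - 2)) + |weightedRemainder α a t₀|) := by gcongr
    _ = _ := by linear_combination (M * t ^ (α - 2)) * hexp

lemma integrableOn_exp_mul_weightedRemainder {α a : ℝ} (hα : 0 < α) (hα1 : α < 1) (ha : 0 < a) :
    IntegrableOn (fun t => Real.exp (-a * t) * weightedRemainder α a t) (Ioi 0) := by
  obtain ⟨t₀, ht₀, M, C, hbound⟩ := exists_abs_exp_mul_weightedRemainder_le hα hα1 ha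
  rw [← Ioc_union_Ioi_eq_Ioi ht₀.le]
  refine IntegrableOn.union ?_ ?_
  · have hcont : Continuous fun t : ℝ => Real.exp (-a * t) *
        (Real.exp (a * t) * t ^ α - a * expPowPrimitive α a t) := by
      have hG : Continuous (expPowPrimitive α a) :=
        continuous_iff_continuousAt.2 fun t => (hasDerivAt_expPowPrimitive hα a t).continuousAt
      have hr := Real.continuous_rpow_const hα.le
      fun_prop
    have hpow : IntegrableOn (fun t : ℝ => α / a * t ^ (α - 1)) (Ioc 0 t₀) :=
      ((intervalIntegrable_iff_integrableOn_Ioc_of_le ht₀.le).1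
        (intervalIntegral.intervalIntegrable_rpow' (by linarith))).const_mul _
    refine (hcont.integrableOn_Ioc.sub hpow).congr (ae_of_all _ fun t => ?_)
    have hexp : Real.exp (-a * t) * Real.exp (a * t) = 1 := by
      rw [← Real.exp_add]; simp
    simp only [Pi.sub_apply, weightedRemainder]
    linear_combination (α / a * t ^ (α - 1)) * hexp
  · have hdom : IntegrableOn (fun t : ℝ => M * t ^ (α - 2) + C * Real.exp (-a * t)) (Ioi t₀) :=
      ((integrableOn_Ioi_rpow_of_lt (by linarith) ht₀).const_mul M).add
        ((integrableOn_exp_mul_Ioi (neg_lt_zero.2 ha) t₀).const_mul C)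
    refine hdom.mono' ?_ ?_
    · refine ContinuousOn.aestronglyMeasurable (fun t ht => ?_) measurableSet_Ioi
      have h := (hasDerivAt_weightedRemainder hα ha.ne' (ht₀.trans ht)).continuousAt
      have he : ContinuousAt (fun t : ℝ => Real.exp (-a * t)) t := by fun_prop
      exact (he.mul h).continuousWithinAt
    · filter_upwards [ae_restrict_mem measurableSet_Ioi] with t ht
      exact hbound t (le_of_lt ht)

lemma integral_sub_rpow_mul_exp (α a t : ℝ) :
    ∫ s in (0 : ℝ)..t, (t - s) ^ α * Real.exp (-a * s)
      = Real.exp (-a * t) * expPowPrimitive α a t := by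
  have h := intervalIntegral.integral_comp_sub_left (a := 0) (b := t)
    (fun u : ℝ => u ^ α * Real.exp (-a * (t - u))) t
  simp only [sub_sub_cancel, sub_self, sub_zero] at h
  rw [h, expPowPrimitive, ← intervalIntegral.integral_const_mul]
  congr 1
  ext u
  rw [show -a * (t - u) = -a * t + a * u by ring, Real.exp_add]
  ring

/-- For `H ∈ (1/2,1)` and `a > 0`, the function `t ↦ K(t) − t^{H−3/2}/(a·Γ(H−1/2))`
is Lebesgue integrable on `(0,∞)`. -/
theorem fouKernel_sub_powerLaw_integrable (H a : ℝ) (hH : 1 / 2 < H) (hH1 : H < 1) (ha : 0 < a) :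
    IntegrableOn
      (fun t : ℝ => fouKernel H a t - t ^ (H - 3 / 2) / (a * Real.Gamma (H - 1 / 2)))
      (Set.Ioi (0 : ℝ)) := by
  have hα : 0 < H - 1 / 2 := by linarith
  refine IntegrableOn.congr_fun ((integrableOn_exp_mul_weightedRemainder hα (by linarith)
    ha).const_mul (1 / Real.Gamma (H + 1 / 2))) (fun t _ => ?_) measurableSet_Ioi
  have hΓ : Real.Gamma (H + 1 / 2) = (H - 1 / 2) * Real.Gamma (H - 1 / 2) := by
    rw [← Real.Gamma_add_one hα.ne']
    congr 1
    ring
  have hΓ0 : Real.Gamma (H - 1 / 2) ≠ 0 := (Real.Gamma_pos_of_pos hα).ne'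
  have hexp : Real.exp (-a * t) * Real.exp (a * t) = 1 := by
    rw [← Real.exp_add]; simp
  have hR : Real.exp (-a * t) * weightedRemainder (H - 1 / 2) a t
      = t ^ (H - 1 / 2) - a * (Real.exp (-a * t) * expPowPrimitive (H - 1 / 2) a t)
        - (H - 1 / 2) / a * t ^ (H - 3 / 2) := by
    rw [weightedRemainder, show H - 1 / 2 - 1 = H - 3 / 2 by ring]
    linear_combination (t ^ (H - 1 / 2) - (H - 1 / 2) / a * t ^ (H - 3 / 2)) * hexp
  have hlast : 1 / Real.Gamma (H + 1 / 2) * ((H - 1 / 2) / a * t ^ (H - 3 / 2))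
      = t ^ (H - 3 / 2) / (a * Real.Gamma (H - 1 / 2)) := by
    rw [hΓ]
    generalize H - 1 / 2 = α at *
    have := hα.ne'
    field_simp
  simp only [fouKernel, integral_sub_rpow_mul_exp, hR]
  rw [← hlast]
  ring
end

section
/- For H ∈ (1/2, 1) and a > 0, the squared fOU moving-average kernel integrates to the stationary fOU variance: ∫₀^∞ K(u)² du = a^{−2H}/(2·sin(πH)). (Equivalently, ∫₀^∞ K(u)² du = σ_ou² where σ_ou² = (1/2)·a^{−2H}·Γ(2H+1)·σ_H² and σ_H² = 1/(Γ(2H+1)·sin(πH)).) -/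
open Real MeasureTheory Set Filter

theorem lintegral_Ioi_rpow_mul_exp_neg_mul {s r : ℝ} (hs : 0 < s) (hr : 0 < r) :
    ∫⁻ x in Ioi (0 : ℝ), ENNReal.ofReal (x ^ (s - 1) * Real.exp (-(r * x))) =
      ENNReal.ofReal (r ^ (-s) * Real.Gamma s) := by
  have key := Real.integral_rpow_mul_exp_neg_mul_Ioi hs hr
  have hpos : 0 < (1 / r) ^ s * Real.Gamma s := by
    have := Real.Gamma_pos_of_pos hs
    positivity
  rw [← ofReal_integral_eq_lintegral_ofReal, key, one_div, Real.inv_rpow hr.le,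
    Real.rpow_neg hr.le]
  · exact Integrable.of_integral_ne_zero (by rw [key]; exact hpos.ne')
  · filter_upwards [ae_restrict_mem measurableSet_Ioi] with x hx
    have : 0 < x := hx
    positivity

theorem lintegral_eq_two_mul_setLIntegral_Ioi_of_even {f : ℝ → ENNReal}
    (hf : ∀ x, f (-x) = f x) : ∫⁻ x, f x = 2 * ∫⁻ x in Ioi (0 : ℝ), f x := by
  have h : ∫⁻ x in Iic (0 : ℝ), f x = ∫⁻ x in Ioi (0 : ℝ), f x := by
    rw [← restrict_Iio_eq_restrict_Iic, ← lintegral_indicator measurableSet_Iio,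
      ← lintegral_indicator measurableSet_Ioi, ← lintegral_neg_eq_self]
    congr with x
    simp [indicator, hf]
  rw [← lintegral_add_compl f measurableSet_Ioi, compl_Ioi, h, two_mul]

/-- The autocorrelation of a nonnegative function on the line. -/
noncomputable def autocorrelation (f : ℝ → ENNReal) (w : ℝ) : ENNReal :=
  ∫⁻ x, f x * f (x + w)

theorem autocorrelation_neg (f : ℝ → ENNReal) (w : ℝ) :
    autocorrelation f (-w) = autocorrelation f w := by
  unfold autocorrelation
  rw [← lintegral_add_right_eq_self _ w]
  simp [mul_comm]

theorem lintegral_convolution_sq {g h : ℝ → ENNReal} (hg : Measurable g) (hh : Measurable h) :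
    ∫⁻ t, (∫⁻ s, h s * g (t - s)) ^ 2 = ∫⁻ w, autocorrelation g w * autocorrelation h w := by
  have square (t : ℝ) : (∫⁻ s, h s * g (t - s)) ^ 2 =
      ∫⁻ w, ∫⁻ y, (h y * h (y + w)) * (g (t - y - w) * g (t - y)) := by
    rw [sq, ← lintegral_lintegral_mul (by fun_prop) (by fun_prop)]
    symm
    rw [lintegral_lintegral_swap (by fun_prop)]
    symm
    refine lintegral_congr fun y => ?_
    rw [← lintegral_add_left_eq_self _ y]
    refine lintegral_congr fun w => ?_
    rw [sub_sub]
    ring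
  simp_rw [square]
  rw [lintegral_lintegral_swap]
  · refine lintegral_congr fun w => ?_
    rw [lintegral_lintegral_swap (by fun_prop)]
    rw [mul_comm, autocorrelation, autocorrelation, ← lintegral_mul_const _ (by fun_prop)]
    refine lintegral_congr fun y => ?_
    rw [lintegral_const_mul _ (by fun_prop)]
    congr 1
    rw [← lintegral_add_right_eq_self _ (y + w)]
    refine lintegral_congr fun t => ?_
    congr 2 <;> ring
  · refine Measurable.aemeasurable ?_
    refine Measurable.lintegral_prod_right' (f := fun p : (ℝ × ℝ) × ℝ =>
      (h p.2 * h (p.2 + p.1.2)) * (g (p.1.1 - p.2 - p.1.2) * g (p.1.1 - p.2))) ?_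
    fun_prop

/-- The function `x ↦ x ^ (α - 1)` on the positive half-line, extended by zero. -/
noncomputable def causalRpow (α : ℝ) : ℝ → ENNReal :=
  (Ioi 0).indicator fun x => ENNReal.ofReal (x ^ (α - 1))

/-- The function `x ↦ exp (-a * x)` on the positive half-line, extended by zero. -/
noncomputable def causalExp (a : ℝ) : ℝ → ENNReal :=
  (Ioi 0).indicator fun x => ENNReal.ofReal (Real.exp (-a * x))

theorem measurable_causalRpow (α : ℝ) : Measurable (causalRpow α) :=
  Measurable.indicator (by fun_prop) measurableSet_Ioi

theorem measurable_causalExp (a : ℝ) : Measurable (causalExp a) :=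
  Measurable.indicator (by fun_prop) measurableSet_Ioi

theorem autocorrelation_causalExp {a w : ℝ} (ha : 0 < a) (hw : 0 < w) :
    autocorrelation (causalExp a) w = ENNReal.ofReal (Real.exp (-(a * w)) / (2 * a)) := by
  have h (x : ℝ) : causalExp a x * causalExp a (x + w) = (Ioi 0).indicator (fun x =>
      ENNReal.ofReal (Real.exp (-(a * w))) *
        ENNReal.ofReal (x ^ ((1 : ℝ) - 1) * Real.exp (-(2 * a * x)))) x := by
    by_cases hx : 0 < x
    · simp only [causalExp, indicator, mem_Ioi, hx, add_pos hx hw, if_true]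
      rw [← ENNReal.ofReal_mul (by positivity), ← ENNReal.ofReal_mul (by positivity), sub_self,
        Real.rpow_zero, one_mul, ← Real.exp_add, ← Real.exp_add]
      ring_nf
    · simp [causalExp, hx]
  simp_rw [autocorrelation, h]
  rw [lintegral_indicator measurableSet_Ioi, lintegral_const_mul _ (by fun_prop),
    lintegral_Ioi_rpow_mul_exp_neg_mul one_pos (by positivity),
    ← ENNReal.ofReal_mul (by positivity), Real.rpow_neg_one, Real.Gamma_one, mul_one,
    div_eq_mul_inv]

theorem autocorrelation_causalRpow {α w : ℝ} (hα : 0 < α) (hα' : α < 1 / 2) (hw : 0 < w) :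
    autocorrelation (causalRpow α) w =
      ENNReal.ofReal (Real.Gamma α * Real.Gamma (1 - 2 * α) / Real.Gamma (1 - α) *
        w ^ (2 * α - 1)) := by
  have hΓ := Real.Gamma_pos_of_pos hα
  have hΓ1 : 0 < Real.Gamma (1 - α) := Real.Gamma_pos_of_pos (by linarith)
  have h (x : ℝ) : causalRpow α x * causalRpow α (x + w) = (Ioi 0).indicator (fun x =>
      ∫⁻ p in Ioi (0 : ℝ), ENNReal.ofReal ((Real.Gamma (1 - α))⁻¹ * x ^ (α - 1) * p ^ (-α) *
        Real.exp (-(p * (x + w))))) x := by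
    by_cases hx : 0 < x
    · have hxw := add_pos hx hw
      simp only [causalRpow, indicator, mem_Ioi, hx, hxw, if_true]
      have key := lintegral_Ioi_rpow_mul_exp_neg_mul (s := 1 - α) (by linarith) hxw
      rw [← ENNReal.ofReal_mul (by positivity)]
      calc _ = ENNReal.ofReal ((Real.Gamma (1 - α))⁻¹ * x ^ (α - 1)) *
              ENNReal.ofReal ((x + w) ^ (-(1 - α)) * Real.Gamma (1 - α)) := by
            rw [← ENNReal.ofReal_mul (by positivity), neg_sub]
            congr 1
            field_simp
        _ = _ := by
            rw [← key, ← lintegral_const_mul _ (by fun_prop)]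
            refine lintegral_congr fun p => ?_
            rw [← ENNReal.ofReal_mul (by positivity)]
            congr 1
            rw [sub_sub_cancel_left, mul_comm p]
            ring
    · simp [causalRpow, hx]
  simp_rw [autocorrelation, h]
  rw [lintegral_indicator measurableSet_Ioi, lintegral_lintegral_swap (by fun_prop)]
  calc _ = ∫⁻ p in Ioi (0 : ℝ), ENNReal.ofReal (Real.Gamma α / Real.Gamma (1 - α)) *
          ENNReal.ofReal (p ^ (1 - 2 * α - 1) * Real.exp (-(w * p))) := by
        refine setLIntegral_congr_fun measurableSet_Ioi fun p hp => ?_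
        have hp : 0 < p := hp
        have key := lintegral_Ioi_rpow_mul_exp_neg_mul hα hp
        calc _ = ∫⁻ x in Ioi (0 : ℝ),
                ENNReal.ofReal ((Real.Gamma (1 - α))⁻¹ * p ^ (-α) * Real.exp (-(w * p))) *
                ENNReal.ofReal (x ^ (α - 1) * Real.exp (-(p * x))) := by
              refine lintegral_congr fun x => ?_
              rw [← ENNReal.ofReal_mul (by positivity), mul_add, neg_add, Real.exp_add,
                mul_comm w p]
              congr 1
              ring
          _ = _ := by
              rw [lintegral_const_mul _ (by fun_prop), key, ← ENNReal.ofReal_mul (by positivity),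
                ← ENNReal.ofReal_mul (by positivity),
                show 1 - 2 * α - 1 = -α + -α by ring, Real.rpow_add hp]
              congr 1
              ring
    _ = _ := by
        rw [lintegral_const_mul _ (by fun_prop),
          lintegral_Ioi_rpow_mul_exp_neg_mul (by linarith) hw,
          ← ENNReal.ofReal_mul (by positivity), neg_sub]
        congr 1
        ring

/-- The `L²` norm of the convolution of the two causal functions. -/
theorem lintegral_causal_convolution_sq {α a : ℝ} (hα : 0 < α) (hα' : α < 1 / 2) (ha : 0 < a) :
    ∫⁻ t, (∫⁻ s, causalExp a s * causalRpow α (t - s)) ^ 2 =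
      ENNReal.ofReal (Real.Gamma α * Real.Gamma (1 - 2 * α) / Real.Gamma (1 - α) / a *
        (a ^ (-(2 * α)) * Real.Gamma (2 * α))) := by
  have hΓ := Real.Gamma_pos_of_pos hα
  have hΓ1 : 0 < Real.Gamma (1 - α) := Real.Gamma_pos_of_pos (by linarith)
  have hΓ2 : 0 < Real.Gamma (1 - 2 * α) := Real.Gamma_pos_of_pos (by linarith)
  rw [lintegral_convolution_sq (measurable_causalRpow α) (measurable_causalExp a),
    lintegral_eq_two_mul_setLIntegral_Ioi_of_even (by simp [autocorrelation_neg]),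
    ← ENNReal.ofReal_ofNat, ENNReal.ofReal_mul (by positivity),
    ← lintegral_Ioi_rpow_mul_exp_neg_mul (by positivity) ha,
    ← lintegral_const_mul' _ _ ENNReal.ofReal_ne_top, ← lintegral_const_mul' _ _ ENNReal.ofReal_ne_top]
  refine setLIntegral_congr_fun measurableSet_Ioi fun w hw => ?_
  have hw : 0 < w := hw
  rw [autocorrelation_causalExp ha hw, autocorrelation_causalRpow hα hα' hw,
    ← ENNReal.ofReal_mul (by positivity), ← ENNReal.ofReal_mul (by positivity),
    ← ENNReal.ofReal_mul (by positivity)]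
  congr 1
  field_simp

theorem rpow_sub_integral_eq {α a t : ℝ} (hα : 0 < α) (ht : 0 < t) :
    t ^ α - a * ∫ s in (0 : ℝ)..t, (t - s) ^ α * Real.exp (-a * s) =
      α * ∫ s in (0 : ℝ)..t, (t - s) ^ (α - 1) * Real.exp (-a * s) := by
  have i1 : IntervalIntegrable (fun s => (t - s) ^ (α - 1) * Real.exp (-a * s)) volume 0 t := by
    refine IntervalIntegrable.mul_continuousOn ?_ (by fun_prop)
    have := (intervalIntegral.intervalIntegrable_rpow' (a := t) (b := 0) (r := α - 1)
      (by linarith)).comp_sub_left t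
    simpa using this
  have c : Continuous fun s : ℝ => (t - s) ^ α * Real.exp (-a * s) :=
    ((continuous_const.sub continuous_id).rpow_const fun _ => Or.inr hα.le).mul (by fun_prop)
  have i2 := c.intervalIntegrable (μ := volume) 0 t
  have i3 : IntervalIntegrable (fun s => -(α * ((t - s) ^ (α - 1) * Real.exp (-a * s))))
      volume 0 t := (i1.const_mul α).neg
  have key := intervalIntegral.integral_eq_sub_of_hasDerivAt_of_le ht.le c.continuousOn
    (f' := fun s => -(α * ((t - s) ^ (α - 1) * Real.exp (-a * s))) -
      a * ((t - s) ^ α * Real.exp (-a * s)))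
    (fun s hs => by
      have h1 : HasDerivAt (fun s : ℝ => (t - s) ^ α) _ s :=
        ((hasDerivAt_id' s).const_sub t).rpow_const (p := α) (Or.inl (by simp; linarith [hs.2]))
      have h2 : HasDerivAt (fun s : ℝ => Real.exp (-a * s)) _ s :=
        ((hasDerivAt_id' s).const_mul (-a)).exp
      exact (h1.fun_mul h2).congr_deriv (by ring))
    (i3.sub (i2.const_mul a))
  rw [intervalIntegral.integral_sub i3 (i2.const_mul a),
    intervalIntegral.integral_neg, intervalIntegral.integral_const_mul,
    intervalIntegral.integral_const_mul] at key
  simp [Real.zero_rpow hα.ne'] at key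
  simp only [neg_mul]
  linarith

theorem fouKernel_eq_toReal {α a t : ℝ} (hα : 0 < α) (ht : 0 < t) :
    fouKernel (α + 1 / 2) a t = (1 / Real.Gamma α) *
      (∫⁻ s, causalExp a s * causalRpow α (t - s)).toReal := by
  have hΓ := Real.Gamma_pos_of_pos hα
  rw [fouKernel, add_sub_cancel_right, rpow_sub_integral_eq hα ht,
    show α + 1 / 2 + 1 / 2 = α + 1 by ring,
    Real.Gamma_add_one hα.ne', intervalIntegral.integral_of_le ht.le, integral_Ioc_eq_integral_Ioo,
    integral_eq_lintegral_of_nonneg_ae]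
  · rw [← lintegral_indicator measurableSet_Ioo]
    have h : (Ioo 0 t).indicator (fun s =>
        ENNReal.ofReal ((t - s) ^ (α - 1) * Real.exp (-a * s))) =
        fun s => causalExp a s * causalRpow α (t - s) := by
      ext s
      by_cases h0 : 0 < s
      · by_cases h1 : s < t
        · have : 0 < t - s := sub_pos.2 h1
          simp only [indicator, causalExp, causalRpow, mem_Ioo, mem_Ioi, h0, h1, this, and_self,
            if_true]
          rw [ENNReal.ofReal_mul (by positivity), mul_comm]
        · simp [indicator, causalRpow, h1]
      · simp [indicator, causalExp, h0]
    rw [h]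
    field_simp
  · filter_upwards [ae_restrict_mem measurableSet_Ioo] with s hs
    have : 0 < t - s := sub_pos.2 hs.2
    positivity
  · exact Measurable.aestronglyMeasurable (by fun_prop)

/-- For `H ∈ (1/2,1)` and `a > 0`, the squared fOU kernel integrates to the stationary fOU
variance: `∫₀^∞ K(u)² du = a^{−2H}/(2 sin(πH))`. -/
theorem fouKernel_sq_integral (H a : ℝ) (hH : 1 / 2 < H) (hH1 : H < 1) (ha : 0 < a) :
    ∫ u in Set.Ioi (0 : ℝ), (fouKernel H a u) ^ 2 =
      a ^ (-(2 * H)) / (2 * Real.sin (Real.pi * H)) := by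
  obtain ⟨α, rfl⟩ : ∃ α, H = α + 1 / 2 := ⟨H - 1 / 2, by ring⟩
  have hα : 0 < α := by linarith
  have hα' : α < 1 / 2 := by linarith
  set L : ℝ → ENNReal := fun t => ∫⁻ s, causalExp a s * causalRpow α (t - s) with hL
  have hLm : Measurable L := by
    have := measurable_causalExp a
    have := measurable_causalRpow α
    exact Measurable.lintegral_prod_right' (f := fun p : ℝ × ℝ =>
      causalExp a p.2 * causalRpow α (p.1 - p.2)) (by fun_prop)
  have hLint : ∫⁻ t in Ioi (0 : ℝ), L t ^ 2 = ∫⁻ t, L t ^ 2 := by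
    refine setLIntegral_eq_of_support_subset fun t ht => ?_
    contrapose! ht
    have : L t = 0 := by
      refine lintegral_eq_zero_of_ae_eq_zero (ae_of_all _ fun s => ?_)
      by_cases hs : 0 < s
      · have : ¬ s < t := fun h => ht (hs.trans h)
        simp [causalRpow, this]
      · simp [causalExp, hs]
    simp [this]
  have hL2 := lintegral_causal_convolution_sq hα hα' ha
  have hfin : ∀ᵐ t ∂(volume.restrict (Ioi (0 : ℝ))), L t ^ 2 < ⊤ := by
    refine ae_lt_top (by fun_prop) ?_
    rw [hLint, hL2]
    exact ENNReal.ofReal_ne_top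
  have hΓ := Real.Gamma_pos_of_pos hα
  have hΓ1 : 0 < Real.Gamma (1 - α) := Real.Gamma_pos_of_pos (by linarith)
  have hΓ2 : 0 < Real.Gamma (1 - 2 * α) := Real.Gamma_pos_of_pos (by linarith)
  have hΓ3 : 0 < Real.Gamma (2 * α) := Real.Gamma_pos_of_pos (by linarith)
  calc _ = ∫ t in Ioi (0 : ℝ), (1 / Real.Gamma α) ^ 2 * (L t ^ 2).toReal := by
        refine setIntegral_congr_fun measurableSet_Ioi fun t ht => ?_
        simp only [fouKernel_eq_toReal hα ht, mul_pow, ENNReal.toReal_pow, hL]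
    _ = (1 / Real.Gamma α) ^ 2 *
          (Real.Gamma α * Real.Gamma (1 - 2 * α) / Real.Gamma (1 - α) / a *
            (a ^ (-(2 * α)) * Real.Gamma (2 * α))) := by
        rw [integral_const_mul, integral_toReal (hLm.pow_const 2).aemeasurable hfin, hLint, hL2,
          ENNReal.toReal_ofReal (by positivity)]
    _ = a ^ (-(2 * α)) / a * (Real.Gamma (2 * α) * Real.Gamma (1 - 2 * α)) /
          (Real.Gamma α * Real.Gamma (1 - α)) := by
        field_simp
    _ = _ := by
        have hs : 0 < Real.sin (Real.pi * α) :=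
          Real.sin_pos_of_pos_of_lt_pi (by positivity) (by nlinarith [Real.pi_pos])
        have hc : 0 < Real.cos (Real.pi * α) :=
          Real.cos_pos_of_mem_Ioo ⟨by nlinarith [Real.pi_pos], by nlinarith [Real.pi_pos]⟩
        rw [Real.Gamma_mul_Gamma_one_sub, Real.Gamma_mul_Gamma_one_sub,
          show Real.pi * (2 * α) = 2 * (Real.pi * α) by ring, Real.sin_two_mul,
          show Real.pi * (α + 1 / 2) = Real.pi * α + Real.pi / 2 by ring,
          Real.sin_add_pi_div_two, show -(2 * (α + 1 / 2)) = -(2 * α) - 1 by ring,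
          Real.rpow_sub_one ha.ne']
        generalize Real.pi * α = x at hs hc ⊢
        field_simp
end

section
/- For H ∈ (1/2, 1), a > 0 and every s ≥ 0, the covariance integral of the fOU moving-average kernel has the spectral representation ∫₀^∞ K(u)·K(u+s) du = (a^{−2H}/π) · ∫₀^∞ cos(a s x) · x^{1−2H}/(1+x²) dx. (This is the covariance E[Y_t^H Y_{t+s}^H] = σ_ou² · (2 sin(πH)/π) ∫₀^∞ cos(a s x) x^{1−2H}/(1+x²) dx of the stationary fOU process.) -/
open Real MeasureTheory Set Filter

open scoped FourierTransform Convolution ComplexConjugate Topology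

/-- The Laplace transform of a real power, on the right half-plane. -/
theorem integral_rpow_mul_cexp_neg_mul_Ioi {α : ℝ} (hα : -1 < α) {p : ℂ} (hp : 0 < p.re) :
    ∫ t in Ioi (0 : ℝ), ((t ^ α : ℝ) : ℂ) * Complex.exp (-p * t) =
      Complex.Gamma (α + 1) * p ^ (-(α + 1) : ℂ) := by
  set μ : Measure ℝ := (volume.restrict (Ioi 0)).withDensity fun t => ENNReal.ofReal (t ^ α)
    with hμ
  have hmeas : Measurable fun t : ℝ => ENNReal.ofReal (t ^ α) := by fun_prop
  have hfin : ∀ᵐ t ∂(volume.restrict (Ioi (0 : ℝ))), ENNReal.ofReal (t ^ α) < ⊤ := by simp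
  have hmgf (z : ℂ) : ProbabilityTheory.complexMGF id μ z =
      ∫ t in Ioi (0 : ℝ), ((t ^ α : ℝ) : ℂ) * Complex.exp (z * t) := by
    rw [ProbabilityTheory.complexMGF, hμ, integral_withDensity_eq_integral_toReal_smul hmeas hfin]
    refine setIntegral_congr_fun measurableSet_Ioi fun t ht => ?_
    have : 0 ≤ t ^ α := rpow_nonneg (le_of_lt ht) _
    simp [this]
  have hsub : Iio 0 ⊆ interior (ProbabilityTheory.integrableExpSet id μ) := by
    rw [isOpen_Iio.subset_interior_iff]
    intro b hb
    rw [ProbabilityTheory.integrableExpSet, mem_ofPred_eq, hμ,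
      integrable_withDensity_iff_integrable_smul' hmeas hfin]
    have h := integrableOn_rpow_mul_exp_neg_mul_rpow hα one_pos (neg_pos.2 hb)
    refine h.congr_fun (fun t ht => ?_) measurableSet_Ioi
    have : 0 ≤ t ^ α := rpow_nonneg (le_of_lt ht) _
    simp [this]
  have hF : AnalyticOnNhd ℂ (fun q : ℂ => ProbabilityTheory.complexMGF id μ (-q))
      {q | 0 < q.re} := by
    intro q hq
    have h1 : AnalyticAt ℂ (ProbabilityTheory.complexMGF id μ) (-q) :=
      ProbabilityTheory.analyticAt_complexMGF (hsub (by simpa using hq))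
    exact h1.fun_comp analyticAt_id.neg
  have hG : AnalyticOnNhd ℂ
      (fun q : ℂ => Complex.Gamma (α + 1) * q ^ (-(α + 1) : ℂ)) {q | 0 < q.re} := by
    intro q hq
    refine analyticAt_const.mul (analyticAt_id.cpow analyticAt_const ?_)
    exact Or.inl hq
  have hreal (r : ℝ) (hr : 0 < r) : ProbabilityTheory.complexMGF id μ (-(r : ℂ)) =
      Complex.Gamma (α + 1) * (r : ℂ) ^ (-(α + 1) : ℂ) := by
    have h := Complex.integral_cpow_mul_exp_neg_mul_Ioi (a := (α + 1 : ℂ)) (r := r)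
      (by simp; linarith) hr
    rw [hmgf, Complex.cpow_neg, ← one_div, mul_comm (Complex.Gamma _)]
    rw [one_div, Complex.inv_cpow _ _ (by
      rw [Complex.arg_ofReal_of_nonneg hr.le]; exact pi_pos.ne)] at h
    rw [one_div, ← h]
    refine setIntegral_congr_fun measurableSet_Ioi fun t ht => ?_
    simp [Complex.ofReal_cpow (le_of_lt ht)]
  have hfreq : ∃ᶠ q in 𝓝[≠] (1 : ℂ), ProbabilityTheory.complexMGF id μ (-q) =
      Complex.Gamma (α + 1) * q ^ (-(α + 1) : ℂ) := by
    have hlim : Tendsto (fun r : ℝ => (r : ℂ)) (𝓝[>] (1 : ℝ)) (𝓝[≠] (1 : ℂ)) := by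
      refine tendsto_nhdsWithin_iff.2 ⟨?_, ?_⟩
      · exact (Complex.continuous_ofReal.tendsto' 1 1 (by simp)).mono_left nhdsWithin_le_nhds
      · filter_upwards [self_mem_nhdsWithin] with r hr
        simpa using (ne_of_gt hr)
    refine hlim.frequently (Eventually.frequently ?_)
    filter_upwards [self_mem_nhdsWithin] with r hr
    exact hreal r (one_pos.trans hr)
  exact (hmgf (-p)).symm.trans (hF.eqOn_of_preconnected_of_frequently_eq hG
    (convex_halfSpace_re_gt 0).isPreconnected (by simp) hfreq hp)

/-- `x ↦ x ^ (-β) / (1 + x ^ 2)` is integrable on the positive half-line for `0 ≤ β < 1`. -/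
theorem integrableOn_rpow_neg_div_one_add_sq {β : ℝ} (hβ0 : 0 ≤ β) (hβ1 : β < 1) :
    IntegrableOn (fun x : ℝ => x ^ (-β) / (1 + x ^ 2)) (Ioi 0) := by
  have hmeas (s : Set ℝ) :
      AEStronglyMeasurable (fun x : ℝ => x ^ (-β) / (1 + x ^ 2)) (volume.restrict s) :=
    Measurable.aestronglyMeasurable (by fun_prop)
  rw [← Ioc_union_Ioi_eq_Ioi (zero_le_one' ℝ)]
  refine IntegrableOn.union ?_ ?_
  · have h : IntegrableOn (fun x : ℝ => x ^ (-β)) (Ioc 0 1) :=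
      (intervalIntegrable_iff_integrableOn_Ioc_of_le zero_le_one).1
        (intervalIntegral.intervalIntegrable_rpow' (by linarith))
    refine h.mono' (hmeas _) ?_
    filter_upwards [ae_restrict_mem measurableSet_Ioc] with x hx
    have hx0 : 0 ≤ x ^ (-β) := rpow_nonneg hx.1.le _
    rw [Real.norm_of_nonneg (by positivity)]
    exact div_le_self hx0 (by nlinarith)
  · refine (integrable_inv_one_add_sq.integrableOn (s := Ioi 1)).mono' (hmeas _) ?_
    filter_upwards [ae_restrict_mem measurableSet_Ioi] with x hx
    have hx1 : (1 : ℝ) < x := hx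
    have hx0 : 0 ≤ x ^ (-β) := rpow_nonneg (by linarith) _
    rw [Real.norm_of_nonneg (by positivity), ← one_div]
    gcongr
    exact rpow_le_one_of_one_le_of_nonpos hx1.le (by linarith)

/-- The function `t ↦ t₊ ^ α * exp (-ε t)`. -/
noncomputable def dampedPow (α ε t : ℝ) : ℂ :=
  (((max t 0) ^ α * Real.exp (-ε * t) : ℝ) : ℂ)

/-- The exponential `t ↦ exp (-b t)` on the positive half-line, extended by zero. -/
noncomputable def dampedExp (b : ℝ) : ℝ → ℂ :=
  (Ioi 0).indicator fun t => ((Real.exp (-b * t) : ℝ) : ℂ)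

/-- The fOU kernel times `exp (-ε t)`, extended by zero to the negative half-line. -/
noncomputable def dampedKernel (H a ε : ℝ) : ℝ → ℝ :=
  (Ioi 0).indicator fun t => Real.exp (-ε * t) * fouKernel H a t

theorem dampedPow_of_nonpos {α : ℝ} (hα : 0 < α) (ε : ℝ) {t : ℝ} (ht : t ≤ 0) :
    dampedPow α ε t = 0 := by
  simp [dampedPow, max_eq_right ht, zero_rpow hα.ne']

theorem dampedPow_eq_indicator {α : ℝ} (hα : 0 < α) (ε : ℝ) :
    dampedPow α ε = (Ioi 0).indicator fun t => ((t ^ α * Real.exp (-ε * t) : ℝ) : ℂ) := by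
  ext t
  by_cases ht : 0 < t
  · rw [indicator_of_mem (mem_Ioi.2 ht), dampedPow, max_eq_left ht.le]
  · rw [indicator_of_notMem (by simpa using ht), dampedPow_of_nonpos hα ε (not_lt.1 ht)]

theorem continuous_dampedPow {α : ℝ} (hα : 0 < α) (ε : ℝ) : Continuous (dampedPow α ε) := by
  unfold dampedPow
  refine Complex.continuous_ofReal.comp (Continuous.mul ?_ (by fun_prop))
  exact (continuous_id.max continuous_const).rpow_const fun _ => Or.inr hα.le

theorem norm_dampedPow_le {α ε : ℝ} (hα : 0 < α) (hα1 : α ≤ 1) (hε : 0 < ε) (t : ℝ) :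
    ‖dampedPow α ε t‖ ≤ 1 + 1 / ε := by
  rcases le_or_gt t 0 with ht | ht
  · rw [dampedPow_of_nonpos hα ε ht, norm_zero]
    positivity
  · rw [dampedPow, max_eq_left ht.le, Complex.norm_real, Real.norm_of_nonneg (by positivity)]
    have h1 : t ^ α ≤ 1 + t := by
      rcases le_total t 1 with h | h
      · exact (rpow_le_one ht.le h hα.le).trans (by linarith)
      · calc t ^ α ≤ t ^ (1 : ℝ) := rpow_le_rpow_of_exponent_le h hα1
          _ ≤ 1 + t := by rw [rpow_one]; linarith
    have h2 : ε * t + 1 ≤ Real.exp (ε * t) := Real.add_one_le_exp _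
    have h3 : 1 + t ≤ (1 + 1 / ε) * Real.exp (ε * t) := by
      calc 1 + t ≤ (1 + 1 / ε) * (ε * t + 1) := by
            have : (1 + 1 / ε) * (ε * t + 1) = 1 + t + (ε * t + 1 / ε) := by field_simp; ring
            rw [this]
            have : 0 ≤ ε * t + 1 / ε := by positivity
            linarith
        _ ≤ _ := by gcongr
    rw [neg_mul, Real.exp_neg, ← div_eq_mul_inv, div_le_iff₀ (Real.exp_pos _)]
    exact h1.trans h3

theorem integrable_dampedPow {α ε : ℝ} (hα : 0 < α) (hε : 0 < ε) :
    Integrable (dampedPow α ε) := by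
  rw [dampedPow_eq_indicator hα, integrable_indicator_iff measurableSet_Ioi]
  have h := integrableOn_rpow_mul_exp_neg_mul_rpow (s := α) (by linarith) one_pos hε
  simp only [rpow_one] at h
  exact h.ofReal (𝕜 := ℂ)

theorem integrable_dampedExp {b : ℝ} (hb : 0 < b) : Integrable (dampedExp b) := by
  rw [dampedExp, integrable_indicator_iff measurableSet_Ioi]
  exact (integrableOn_exp_mul_Ioi (neg_neg_iff_pos.2 hb) 0).ofReal (𝕜 := ℂ)

theorem fourier_indicator_Ioi (f : ℝ → ℂ) (ξ : ℝ) :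
    𝓕 ((Ioi 0).indicator f) ξ =
      ∫ t in Ioi (0 : ℝ), f t * Complex.exp (-(2 * π * ξ * Complex.I) * t) := by
  rw [Real.fourier_real_eq_integral_exp_smul, ← integral_indicator measurableSet_Ioi]
  congr 1 with t
  by_cases ht : t ∈ Ioi (0 : ℝ)
  · simp only [indicator_of_mem ht, smul_eq_mul]
    rw [mul_comm]
    congr 2
    push_cast
    ring
  · simp [indicator_of_notMem ht]

theorem fourier_dampedPow {α ε : ℝ} (hα : 0 < α) (hε : 0 < ε) (ξ : ℝ) :
    𝓕 (dampedPow α ε) ξ =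
      Complex.Gamma (α + 1) * (ε + 2 * π * ξ * Complex.I : ℂ) ^ (-(α + 1) : ℂ) := by
  rw [dampedPow_eq_indicator hα, fourier_indicator_Ioi,
    ← integral_rpow_mul_cexp_neg_mul_Ioi (by linarith) (by simpa using hε)]
  congr 1 with t
  rw [Complex.ofReal_mul, Complex.ofReal_exp, mul_assoc, ← Complex.exp_add]
  congr 2
  push_cast
  ring

theorem fourier_dampedExp {b : ℝ} (hb : 0 < b) (ξ : ℝ) :
    𝓕 (dampedExp b) ξ = (b + 2 * π * ξ * Complex.I : ℂ)⁻¹ := by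
  have h := integral_exp_mul_complex_Ioi (a := -(b + 2 * π * ξ * Complex.I : ℂ))
    (by simpa using hb) 0
  rw [dampedExp, fourier_indicator_Ioi]
  simp only [Complex.ofReal_zero, mul_zero, Complex.exp_zero, neg_div_neg_eq, one_div] at h
  rw [← h]
  congr 1 with t
  rw [Complex.ofReal_exp, ← Complex.exp_add]
  congr 1
  push_cast
  ring

theorem convolution_dampedExp_dampedPow {α : ℝ} (hα : 0 < α) (a ε : ℝ) :
    dampedExp (a + ε) ⋆[ContinuousLinearMap.mul ℂ ℂ] dampedPow α ε =
      (Ioi 0).indicator fun t => ((Real.exp (-ε * t) *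
        ∫ s in (0 : ℝ)..t, (t - s) ^ α * Real.exp (-a * s) : ℝ) : ℂ) := by
  ext t
  rw [convolution]
  simp only [ContinuousLinearMap.mul_apply']
  by_cases ht : 0 < t
  · rw [indicator_of_mem (mem_Ioi.2 ht), ← intervalIntegral.integral_const_mul,
      intervalIntegral.integral_of_le ht.le, ← integral_complex_ofReal,
      ← integral_indicator measurableSet_Ioc]
    congr 1 with s
    by_cases hs : 0 < s
    · by_cases hst : s ≤ t
      · rw [indicator_of_mem (mem_Ioc.2 ⟨hs, hst⟩), dampedExp, indicator_of_mem (mem_Ioi.2 hs),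
          dampedPow, max_eq_left (sub_nonneg.2 hst), ← Complex.ofReal_mul]
        congr 1
        have : Real.exp (-(a + ε) * s) * Real.exp (-ε * (t - s)) =
            Real.exp (-ε * t) * Real.exp (-a * s) := by
          rw [← Real.exp_add, ← Real.exp_add]
          ring_nf
        linear_combination (t - s) ^ α * this
      · rw [indicator_of_notMem (fun h => hst h.2),
          dampedPow_of_nonpos hα ε (by linarith), mul_zero]
    · rw [indicator_of_notMem (fun h => hs h.1), dampedExp,
        indicator_of_notMem (by simpa using hs), zero_mul]
  · rw [indicator_of_notMem (by simpa using ht)]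
    refine integral_eq_zero_of_ae (Eventually.of_forall fun s => ?_)
    by_cases hs : 0 < s
    · simp [dampedPow_of_nonpos hα ε (by linarith : t - s ≤ 0)]
    · simp [dampedExp, indicator_of_notMem (by simpa using hs : s ∉ Ioi (0 : ℝ))]

theorem ofReal_dampedKernel {H : ℝ} (hH : 1 / 2 < H) (a ε : ℝ) :
    (fun t => (dampedKernel H a ε t : ℂ)) = ((1 / Real.Gamma (H + 1 / 2) : ℝ) : ℂ) •
      (dampedPow (H - 1 / 2) ε - (a : ℂ) •
        (dampedExp (a + ε) ⋆[ContinuousLinearMap.mul ℂ ℂ] dampedPow (H - 1 / 2) ε)) := by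
  have hα : 0 < H - 1 / 2 := by linarith
  rw [convolution_dampedExp_dampedPow hα, dampedPow_eq_indicator hα]
  ext t
  by_cases ht : t ∈ Ioi (0 : ℝ)
  · simp only [dampedKernel, fouKernel, Pi.smul_apply, Pi.sub_apply, indicator_of_mem ht,
      smul_eq_mul]
    norm_cast
    ring
  · simp [dampedKernel, indicator_of_notMem ht]

theorem continuous_dampedKernel {H a ε : ℝ} (hH : 1 / 2 < H) (hH1 : H < 1) (ha : 0 < a)
    (hε : 0 < ε) : Continuous fun t => (dampedKernel H a ε t : ℂ) := by
  have hα : 0 < H - 1 / 2 := by linarith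
  rw [ofReal_dampedKernel hH]
  have hc : Continuous
      (dampedExp (a + ε) ⋆[ContinuousLinearMap.mul ℂ ℂ] dampedPow (H - 1 / 2) ε) :=
    BddAbove.continuous_convolution_right_of_integrable _
      ⟨1 + 1 / ε, by
        rintro _ ⟨t, rfl⟩
        exact norm_dampedPow_le hα (by linarith) hε t⟩
      (integrable_dampedExp (by linarith)) (continuous_dampedPow hα ε)
  exact ((continuous_dampedPow hα ε).sub (hc.const_smul _)).const_smul _

theorem integrable_dampedKernel {H a ε : ℝ} (hH : 1 / 2 < H) (ha : 0 < a) (hε : 0 < ε) :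
    Integrable fun t => (dampedKernel H a ε t : ℂ) := by
  have hα : 0 < H - 1 / 2 := by linarith
  rw [ofReal_dampedKernel hH]
  have hc := (integrable_dampedExp (b := a + ε) (by linarith)).integrable_convolution
    (ContinuousLinearMap.mul ℂ ℂ) (integrable_dampedPow hα hε)
  exact ((integrable_dampedPow hα hε).sub (hc.smul _)).smul _

theorem fourier_dampedKernel {H a ε : ℝ} (hH : 1 / 2 < H) (ha : 0 < a) (hε : 0 < ε) (ξ : ℝ) :
    𝓕 (fun t => (dampedKernel H a ε t : ℂ)) ξ =
      (ε + 2 * π * ξ * Complex.I : ℂ) ^ (-(H - 1 / 2) : ℂ) /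
        (a + ε + 2 * π * ξ * Complex.I) := by
  have hα : 0 < H - 1 / 2 := by linarith
  have hp : (ε + 2 * π * ξ * Complex.I : ℂ) ≠ 0 := fun h => by
    have := congrArg Complex.re h
    simp at this
    linarith
  have hq : (a + ε + 2 * π * ξ * Complex.I : ℂ) ≠ 0 := fun h => by
    have := congrArg Complex.re h
    simp at this
    linarith
  have hΓ : (Real.Gamma (H + 1 / 2) : ℂ) ≠ 0 :=
    Complex.ofReal_ne_zero.2 (Real.Gamma_pos_of_pos (by linarith)).ne'
  have hE := integrable_dampedExp (b := a + ε) (by linarith)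
  have hP := integrable_dampedPow hα hε
  have hc := hE.integrable_convolution (ContinuousLinearMap.mul ℂ ℂ) hP
  rw [ofReal_dampedKernel hH]
  have hlin : 𝓕 (((1 / Real.Gamma (H + 1 / 2) : ℝ) : ℂ) •
      (dampedPow (H - 1 / 2) ε - (a : ℂ) •
        (dampedExp (a + ε) ⋆[ContinuousLinearMap.mul ℂ ℂ] dampedPow (H - 1 / 2) ε))) ξ =
      ((1 / Real.Gamma (H + 1 / 2) : ℝ) : ℂ) * (𝓕 (dampedPow (H - 1 / 2) ε) ξ - a *
        𝓕 (dampedExp (a + ε) ⋆[ContinuousLinearMap.mul ℂ ℂ] dampedPow (H - 1 / 2) ε) ξ) := by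
    have h1 := (Real.fourierIntegral_convergent_iff ξ).2 hP
    have h2 := ((Real.fourierIntegral_convergent_iff ξ).2 hc).const_mul (a : ℂ)
    simp only [Real.fourier_eq]
    rw [← integral_const_mul, ← integral_sub h1 h2, ← integral_const_mul]
    congr 1 with v
    simp only [Circle.smul_def, Pi.smul_apply, Pi.sub_apply, smul_eq_mul]
    ring
  rw [hlin, Real.fourier_mul_convolution_eq hE hP, fourier_dampedPow hα hε,
    fourier_dampedExp (by linarith)]
  have hG : Complex.Gamma (((H - 1 / 2 : ℝ) : ℂ) + 1) = (Real.Gamma (H + 1 / 2) : ℂ) := by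
    rw [← Complex.Gamma_ofReal]
    congr 1
    push_cast
    ring
  have hpow : (ε + 2 * π * ξ * Complex.I : ℂ) ^ (-(H - 1 / 2) : ℂ) =
      (ε + 2 * π * ξ * Complex.I : ℂ) ^ (-(((H - 1 / 2 : ℝ) : ℂ) + 1)) *
        (ε + 2 * π * ξ * Complex.I : ℂ) := by
    nth_rw 3 [← Complex.cpow_one (ε + 2 * π * ξ * Complex.I : ℂ)]
    rw [← Complex.cpow_add _ _ hp]
    congr 1
    push_cast
    ring
  rw [hG, hpow]
  generalize (ε + 2 * π * ξ * Complex.I : ℂ) ^ (-(((H - 1 / 2 : ℝ) : ℂ) + 1)) = w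
  rw [add_assoc] at hq ⊢
  push_cast
  rw [add_assoc]
  generalize (ε + 2 * π * ξ * Complex.I : ℂ) = z at hq ⊢
  generalize (Real.Gamma (H + 1 / 2) : ℂ) = G at hΓ ⊢
  field_simp
  ring

theorem fouKernel_nonneg {H a t : ℝ} (hH : 1 / 2 < H) (ha : 0 < a) (ht : 0 ≤ t) :
    0 ≤ fouKernel H a t := by
  have hα : 0 < H - 1 / 2 := by linarith
  have hcont : Continuous fun s : ℝ => (t - s) ^ (H - 1 / 2) * Real.exp (-a * s) :=
    ((continuous_const.sub continuous_id).rpow_const fun _ => Or.inr hα.le).mul (by fun_prop)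
  have hle : ∫ s in (0 : ℝ)..t, (t - s) ^ (H - 1 / 2) * Real.exp (-a * s) ≤
      ∫ s in (0 : ℝ)..t, t ^ (H - 1 / 2) * Real.exp (-a * s) := by
    refine intervalIntegral.integral_mono_on ht (hcont.intervalIntegrable _ _)
      (Continuous.intervalIntegrable (by fun_prop) _ _) fun s hs => ?_
    have : 0 ≤ t - s := by linarith [hs.2]
    have : t - s ≤ t := by linarith [hs.1]
    gcongr
  have hexp : ∫ s in (0 : ℝ)..t, Real.exp (-a * s) = (1 - Real.exp (-a * t)) / a := by
    rw [intervalIntegral.integral_comp_mul_left (fun x => Real.exp x) (neg_ne_zero.2 ha.ne'),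
      integral_exp, smul_eq_mul, mul_zero, Real.exp_zero]
    field_simp
    ring
  rw [intervalIntegral.integral_const_mul, hexp] at hle
  refine mul_nonneg (one_div_nonneg.2 (Real.Gamma_pos_of_pos (by linarith)).le) ?_
  have h1 : a * ∫ s in (0 : ℝ)..t, (t - s) ^ (H - 1 / 2) * Real.exp (-a * s) ≤
      t ^ (H - 1 / 2) * (1 - Real.exp (-a * t)) := by
    calc _ ≤ a * (t ^ (H - 1 / 2) * ((1 - Real.exp (-a * t)) / a)) := by gcongr
      _ = _ := by field_simp
  have h2 : 0 ≤ t ^ (H - 1 / 2) * Real.exp (-a * t) := by positivity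
  linarith

theorem fouKernel_le {H a t : ℝ} (hH : 1 / 2 < H) (ha : 0 < a) (ht : 0 ≤ t) :
    fouKernel H a t ≤ 1 / Real.Gamma (H + 1 / 2) * t ^ (H - 1 / 2) := by
  refine mul_le_mul_of_nonneg_left ?_
    (one_div_nonneg.2 (Real.Gamma_pos_of_pos (by linarith)).le)
  have : 0 ≤ ∫ s in (0 : ℝ)..t, (t - s) ^ (H - 1 / 2) * Real.exp (-a * s) := by
    refine intervalIntegral.integral_nonneg ht fun s hs => ?_
    have : 0 ≤ t - s := by linarith [hs.2]
    positivity
  nlinarith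

theorem norm_dampedKernel_le {H a ε : ℝ} (hH : 1 / 2 < H) (hH1 : H < 1) (ha : 0 < a)
    (hε : 0 < ε) (t : ℝ) :
    ‖(dampedKernel H a ε t : ℂ)‖ ≤ 1 / Real.Gamma (H + 1 / 2) * (1 + 1 / ε) := by
  have hΓ : 0 < Real.Gamma (H + 1 / 2) := Real.Gamma_pos_of_pos (by linarith)
  rcases le_or_gt t 0 with ht | ht
  · rw [dampedKernel, indicator_of_notMem (by simpa using ht), Complex.ofReal_zero, norm_zero]
    positivity
  · have h1 := norm_dampedPow_le (α := H - 1 / 2) (by linarith) (by linarith) hε t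
    have h2 := fouKernel_nonneg hH ha ht.le
    rw [dampedPow, max_eq_left ht.le, Complex.norm_real, Real.norm_of_nonneg (by positivity)]
      at h1
    rw [dampedKernel, indicator_of_mem (mem_Ioi.2 ht), Complex.norm_real,
      Real.norm_of_nonneg (by positivity)]
    calc Real.exp (-ε * t) * fouKernel H a t
        ≤ Real.exp (-ε * t) * (1 / Real.Gamma (H + 1 / 2) * t ^ (H - 1 / 2)) := by
          gcongr
          exact fouKernel_le hH ha ht.le
      _ = 1 / Real.Gamma (H + 1 / 2) * (t ^ (H - 1 / 2) * Real.exp (-ε * t)) := by ring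
      _ ≤ _ := by gcongr

theorem fourier_ofReal_comp_neg (f : ℝ → ℝ) (ξ : ℝ) :
    𝓕 (fun t => (f (-t) : ℂ)) ξ = conj (𝓕 (fun t => (f t : ℂ)) ξ) := by
  rw [Real.fourier_real_eq_integral_exp_smul, Real.fourier_real_eq_integral_exp_smul,
    ← integral_conj, ← integral_neg_eq_self]
  congr 1 with t
  simp [← Complex.exp_conj, Complex.conj_ofNat]

theorem normSq_fourier_dampedKernel {H a ε : ℝ} (hH : 1 / 2 < H) (ha : 0 < a) (hε : 0 < ε)
    (ξ : ℝ) :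
    Complex.normSq (𝓕 (fun t => (dampedKernel H a ε t : ℂ)) ξ) =
      (ε ^ 2 + (2 * π * ξ) ^ 2) ^ (-(H - 1 / 2)) / ((a + ε) ^ 2 + (2 * π * ξ) ^ 2) := by
  have hnorm (b : ℝ) : Complex.normSq (b + 2 * π * ξ * Complex.I) =
      b ^ 2 + (2 * π * ξ) ^ 2 := by
    rw [← Complex.normSq_add_mul_I]
    push_cast
    rfl
  have hq := hnorm (a + ε)
  push_cast at hq
  have hexp : (-(H - 1 / 2) : ℂ) = ((-(H - 1 / 2) : ℝ) : ℂ) := by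
    push_cast
    rfl
  have hpow (z : ℂ) (y : ℝ) : Complex.normSq (z ^ (y : ℂ)) = Complex.normSq z ^ y := by
    rw [Complex.normSq_eq_norm_sq, Complex.normSq_eq_norm_sq, Complex.norm_cpow_real,
      ← Real.rpow_natCast, ← Real.rpow_natCast, ← Real.rpow_mul (norm_nonneg _),
      ← Real.rpow_mul (norm_nonneg _), mul_comm]
  rw [fourier_dampedKernel hH ha hε, Complex.normSq_div, hq, hexp, hpow, hnorm]

theorem integrable_dampedSpectrum {a α ε : ℝ} (hα : 0 ≤ α) (ha : 0 < a) (hε : 0 < ε) :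
    Integrable fun ξ : ℝ =>
      (ε ^ 2 + (2 * π * ξ) ^ 2) ^ (-α) / ((a + ε) ^ 2 + (2 * π * ξ) ^ 2) := by
  have hb : 2 * π / (a + ε) ≠ 0 := by positivity
  have h := ((integrable_inv_one_add_sq.comp_mul_left' hb).const_mul
    ((ε ^ 2) ^ (-α) / (a + ε) ^ 2))
  refine h.mono' (Measurable.aestronglyMeasurable (by fun_prop)) (Eventually.of_forall fun ξ => ?_)
  rw [Real.norm_of_nonneg (by positivity)]
  calc _ ≤ (ε ^ 2) ^ (-α) / ((a + ε) ^ 2 + (2 * π * ξ) ^ 2) := by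
        refine div_le_div_of_nonneg_right ?_ (by positivity)
        exact rpow_le_rpow_of_nonpos (by positivity) (by nlinarith [sq_nonneg (2 * π * ξ)])
          (by linarith)
    _ = _ := by
        generalize (ε ^ 2) ^ (-α) = w
        field_simp

theorem integral_dampedKernel_mul {H a ε : ℝ} (hH : 1 / 2 < H) (hH1 : H < 1) (ha : 0 < a)
    (hε : 0 < ε) (s : ℝ) :
    ∫ u, dampedKernel H a ε u * dampedKernel H a ε (u + s) =
      ∫ ξ : ℝ, Real.cos (2 * π * ξ * s) *
        ((ε ^ 2 + (2 * π * ξ) ^ 2) ^ (-(H - 1 / 2)) / ((a + ε) ^ 2 + (2 * π * ξ) ^ 2)) := by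
  set k : ℝ → ℂ := fun t => (dampedKernel H a ε t : ℂ) with hk
  set r : ℝ → ℂ := fun t => (dampedKernel H a ε (-t) : ℂ) with hr
  have hki : Integrable k := integrable_dampedKernel hH ha hε
  have hri : Integrable r := hki.comp_neg
  have hkc : Continuous k := continuous_dampedKernel hH hH1 ha hε
  have hcont : Continuous (r ⋆[ContinuousLinearMap.mul ℂ ℂ] k) :=
    BddAbove.continuous_convolution_right_of_integrable _
      ⟨_, by
        rintro _ ⟨t, rfl⟩
        exact norm_dampedKernel_le hH hH1 ha hε t⟩ hri hkc
  have hint := hri.integrable_convolution (ContinuousLinearMap.mul ℂ ℂ) hki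
  have hF : 𝓕 (r ⋆[ContinuousLinearMap.mul ℂ ℂ] k) = fun ξ : ℝ =>
      (((ε ^ 2 + (2 * π * ξ) ^ 2) ^ (-(H - 1 / 2)) /
        ((a + ε) ^ 2 + (2 * π * ξ) ^ 2) : ℝ) : ℂ) := by
    ext ξ
    rw [Real.fourier_mul_convolution_eq hri hki, hr, fourier_ofReal_comp_neg,
      ← normSq_fourier_dampedKernel hH ha hε, Complex.normSq_eq_conj_mul_self]
  have hP := integrable_dampedSpectrum (a := a) (α := H - 1 / 2) (by linarith) ha hε
  have hinv := congrFun (hcont.fourierInv_fourier_eq hint (by rw [hF]; exact hP.ofReal)) s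
  have hconv : (r ⋆[ContinuousLinearMap.mul ℂ ℂ] k) s =
      ((∫ u, dampedKernel H a ε u * dampedKernel H a ε (u + s) : ℝ) : ℂ) := by
    rw [convolution, ← integral_complex_ofReal, ← integral_neg_eq_self]
    congr 1 with u
    simp [hr, hk, add_comm]
  rw [hconv, hF, Real.fourierInv_eq'] at hinv
  have hre := congrArg Complex.re hinv
  rw [Complex.ofReal_re] at hre
  rw [← hre, ← RCLike.re_to_complex, ← integral_re]
  · congr 1 with ξ
    rw [smul_eq_mul, RCLike.re_to_complex, Complex.re_mul_ofReal, Complex.exp_ofReal_mul_I_re]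
    congr 2
    simp
    ring
  · refine (hP.ofReal (𝕜 := ℂ)).bdd_mul (c := 1) (Continuous.aestronglyMeasurable (by fun_prop))
      (Eventually.of_forall fun ξ => ?_)
    rw [Complex.norm_exp_ofReal_mul_I]

theorem integral_cos_mul_comp_sq {a : ℝ} (ha : 0 < a) (s : ℝ) (Q : ℝ → ℝ) :
    ∫ ξ : ℝ, Real.cos (2 * π * ξ * s) * Q ((2 * π * ξ) ^ 2) =
      a / π * ∫ x in Ioi (0 : ℝ), Real.cos (a * s * x) * Q ((a * x) ^ 2) := by
  have hπ := pi_pos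
  have hb : 0 < a / (2 * π) := by positivity
  set f : ℝ → ℝ := fun ξ => Real.cos (2 * π * ξ * s) * Q ((2 * π * ξ) ^ 2) with hf
  have habs (ξ : ℝ) : f |ξ| = f ξ := by
    rcases abs_choice ξ with h | h
    · rw [h]
    · simp [hf, h]
  have h1 : ∫ ξ, f ξ = 2 * ∫ ξ in Ioi (0 : ℝ), f ξ := by
    rw [← integral_comp_abs]
    simp only [habs]
  have h2 := integral_comp_mul_left_Ioi' f 0 hb
  rw [mul_zero, smul_eq_mul] at h2
  rw [h1, ← h2, ← mul_assoc]
  congr 1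
  · field_simp
  · congr 1 with x
    have : 2 * π * (a / (2 * π) * x) = a * x := by field_simp
    simp only [hf, this]
    congr 2
    ring

theorem tendsto_integral_dampedSpectrum {a α : ℝ} (hα : 0 < α) (hα1 : α < 1 / 2) (ha : 0 < a)
    (s : ℝ) {ε : ℕ → ℝ} (hε : ∀ n, 0 < ε n) (hlim : Tendsto ε atTop (𝓝 0)) :
    Tendsto (fun n => ∫ x in Ioi (0 : ℝ), Real.cos (a * s * x) *
        ((ε n ^ 2 + (a * x) ^ 2) ^ (-α) / ((a + ε n) ^ 2 + (a * x) ^ 2))) atTop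
      (𝓝 (a ^ (-(2 * α) - 2) *
        ∫ x in Ioi (0 : ℝ), Real.cos (a * s * x) * x ^ (-(2 * α)) / (1 + x ^ 2))) := by
  have hzero (x : ℝ) (hx : 0 < x) : ((a * x) ^ 2) ^ (-α) / (a ^ 2 + (a * x) ^ 2) =
      a ^ (-(2 * α) - 2) * (x ^ (-(2 * α)) / (1 + x ^ 2)) := by
    have h1 : ((a * x) ^ 2) ^ (-α) = a ^ (-(2 * α)) * x ^ (-(2 * α)) := by
      rw [← Real.rpow_natCast, ← Real.rpow_mul (by positivity), Real.mul_rpow ha.le hx.le]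
      push_cast
      rw [show (2 : ℝ) * -α = -(2 * α) by ring]
    have h2 : a ^ (-(2 * α) - 2) = a ^ (-(2 * α)) / a ^ 2 := by
      rw [Real.rpow_sub ha]
      norm_cast
    rw [h1, h2]
    field_simp
  rw [← integral_const_mul]
  refine tendsto_integral_of_dominated_convergence
    (fun x => a ^ (-(2 * α) - 2) * (x ^ (-(2 * α)) / (1 + x ^ 2)))
    (fun n => Measurable.aestronglyMeasurable (by fun_prop))
    ((integrableOn_rpow_neg_div_one_add_sq (by linarith) (by linarith)).const_mul _)
    (fun n => ?_) ?_
  · filter_upwards [ae_restrict_mem measurableSet_Ioi] with x hx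
    have hx : 0 < x := hx
    have hn := hε n
    rw [← hzero x hx, norm_mul]
    refine (mul_le_of_le_one_left (norm_nonneg _) (Real.abs_cos_le_one _)).trans ?_
    rw [Real.norm_of_nonneg (by positivity)]
    have h1 : (ε n ^ 2 + (a * x) ^ 2) ^ (-α) ≤ ((a * x) ^ 2) ^ (-α) :=
      rpow_le_rpow_of_nonpos (by positivity) (by nlinarith) (by linarith)
    gcongr
    linarith
  · filter_upwards [ae_restrict_mem measurableSet_Ioi] with x hx
    have hx : 0 < x := hx
    rw [show a ^ (-(2 * α) - 2) * (Real.cos (a * s * x) * x ^ (-(2 * α)) / (1 + x ^ 2)) =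
      Real.cos (a * s * x) * (((0 : ℝ) ^ 2 + (a * x) ^ 2) ^ (-α) /
        ((a + 0) ^ 2 + (a * x) ^ 2)) by
      rw [add_zero, zero_pow two_ne_zero, zero_add, hzero x hx]
      ring]
    have hpos : 0 < (a * x) ^ 2 := by positivity
    refine Tendsto.mul tendsto_const_nhds (Tendsto.div ?_ ?_ (by positivity))
    · exact ((hlim.pow 2).add_const _).rpow_const (Or.inl (by positivity))
    · exact ((hlim.const_add a).pow 2).add_const _

/-- Monotone convergence for real-valued functions, without integrability of the limit. -/
theorem integral_eq_of_tendsto_of_monotone {X : Type*} [MeasurableSpace X] {μ : Measure X}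
    {f : ℕ → X → ℝ} {F : X → ℝ} {L : ℝ} (hf : ∀ n, Integrable (f n) μ)
    (h0 : ∀ n, ∀ᵐ x ∂μ, 0 ≤ f n x) (hmono : ∀ᵐ x ∂μ, Monotone fun n => f n x)
    (hlim : ∀ᵐ x ∂μ, Tendsto (fun n => f n x) atTop (𝓝 (F x)))
    (hL : Tendsto (fun n => ∫ x, f n x ∂μ) atTop (𝓝 L)) :
    ∫ x, F x ∂μ = L := by
  have h1 := lintegral_tendsto_of_tendsto_of_monotone (μ := μ)
    (f := fun n x => ENNReal.ofReal (f n x)) (F := fun x => ENNReal.ofReal (F x))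
    (fun n => (hf n).aemeasurable.ennreal_ofReal)
    (hmono.mono fun x hx _ _ hij => ENNReal.ofReal_le_ofReal (hx hij))
    (hlim.mono fun x hx => (ENNReal.continuous_ofReal.tendsto _).comp hx)
  have h2 (n : ℕ) : ∫⁻ x, ENNReal.ofReal (f n x) ∂μ = ENNReal.ofReal (∫ x, f n x ∂μ) :=
    (ofReal_integral_eq_lintegral_ofReal (hf n) (h0 n)).symm
  simp only [h2] at h1
  have h3 := tendsto_nhds_unique h1 ((ENNReal.continuous_ofReal.tendsto _).comp hL)
  have hF0 : ∀ᵐ x ∂μ, 0 ≤ F x := by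
    filter_upwards [hlim, ae_all_iff.2 h0] with x hx hx0
    exact ge_of_tendsto' hx hx0
  have hFm : AEStronglyMeasurable F μ :=
    aestronglyMeasurable_of_tendsto_ae atTop (fun n => (hf n).aestronglyMeasurable) hlim
  rw [integral_eq_lintegral_of_nonneg_ae hF0 hFm, h3, ENNReal.toReal_ofReal]
  exact ge_of_tendsto' hL fun n => integral_nonneg_of_ae (h0 n)

theorem dampedKernel_mul_eq {H a ε s : ℝ} (hs : 0 ≤ s) :
    (fun u => dampedKernel H a ε u * dampedKernel H a ε (u + s)) = (Ioi 0).indicator fun u =>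
      Real.exp (-ε * (2 * u + s)) * (fouKernel H a u * fouKernel H a (u + s)) := by
  ext u
  by_cases hu : u ∈ Ioi (0 : ℝ)
  · have hus : u + s ∈ Ioi (0 : ℝ) := add_pos_of_pos_of_nonneg hu hs
    rw [dampedKernel, indicator_of_mem hu, indicator_of_mem hus, indicator_of_mem hu,
      show -ε * (2 * u + s) = -ε * u + -ε * (u + s) by ring, Real.exp_add]
    ring
  · rw [dampedKernel, indicator_of_notMem hu, indicator_of_notMem hu, zero_mul]

theorem integrable_dampedKernel_mul {H a ε : ℝ} (hH : 1 / 2 < H) (hH1 : H < 1) (ha : 0 < a)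
    (hε : 0 < ε) (s : ℝ) :
    Integrable fun u => dampedKernel H a ε u * dampedKernel H a ε (u + s) := by
  have hk : Integrable (dampedKernel H a ε) := by
    simpa using (integrable_dampedKernel hH ha hε).re
  refine hk.mul_bdd (hk.comp_add_right s).aestronglyMeasurable
    (c := 1 / Real.Gamma (H + 1 / 2) * (1 + 1 / ε)) (Eventually.of_forall fun u => ?_)
  rw [← Complex.norm_real]
  exact norm_dampedKernel_le hH hH1 ha hε (u + s)

/-- For `H ∈ (1/2,1)`, `a > 0`, `s ≥ 0`, the covariance integral of the fOU kernel has the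
spectral representation
`∫₀^∞ K(u)K(u+s) du = (a^{−2H}/π) ∫₀^∞ cos(a s x)·x^{1−2H}/(1+x²) dx`. -/
theorem fouKernel_covariance_spectral (H a : ℝ) (hH : 1 / 2 < H) (hH1 : H < 1) (ha : 0 < a) :
    ∀ s : ℝ, 0 ≤ s →
      ∫ u in Set.Ioi (0 : ℝ), fouKernel H a u * fouKernel H a (u + s) =
        (a ^ (-(2 * H)) / Real.pi) *
          ∫ x in Set.Ioi (0 : ℝ), Real.cos (a * s * x) * x ^ (1 - 2 * H) / (1 + x ^ 2) := by
  intro s hs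
  set ε : ℕ → ℝ := fun n => 1 / ((n : ℝ) + 1) with hε_def
  have hε (n : ℕ) : 0 < ε n := Nat.one_div_pos_of_nat
  have hlim : Tendsto ε atTop (𝓝 0) := tendsto_one_div_add_atTop_nhds_zero_nat
  have hanti : Antitone ε := fun m n hmn => Nat.one_div_le_one_div hmn
  refine integral_eq_of_tendsto_of_monotone (f := fun n u =>
    Real.exp (-ε n * (2 * u + s)) * (fouKernel H a u * fouKernel H a (u + s)))
    (fun n => ?_) (fun n => ?_) ?_ ?_ ?_
  · have h := integrable_dampedKernel_mul hH hH1 ha (hε n) s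
    rwa [dampedKernel_mul_eq hs, integrable_indicator_iff measurableSet_Ioi] at h
  · filter_upwards [ae_restrict_mem measurableSet_Ioi] with u hu
    have hu : 0 < u := hu
    have h1 := fouKernel_nonneg hH ha hu.le
    have h2 := fouKernel_nonneg hH ha (add_nonneg hu.le hs)
    positivity
  · filter_upwards [ae_restrict_mem measurableSet_Ioi] with u hu m n hmn
    have hu : 0 < u := hu
    have h1 := fouKernel_nonneg hH ha hu.le
    have h2 := fouKernel_nonneg hH ha (add_nonneg hu.le hs)
    have h3 := hanti hmn
    refine mul_le_mul_of_nonneg_right (Real.exp_le_exp.2 ?_) (mul_nonneg h1 h2)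
    nlinarith
  · refine Eventually.of_forall fun u => ?_
    have h : Tendsto (fun n => Real.exp (-ε n * (2 * u + s))) atTop (𝓝 1) := by
      have := (Real.continuous_exp.tendsto _).comp (hlim.neg.mul_const (2 * u + s))
      simpa [Function.comp_def] using this
    simpa using h.mul_const (fouKernel H a u * fouKernel H a (u + s))
  · have h := (tendsto_integral_dampedSpectrum (α := H - 1 / 2) (by linarith) (by linarith)
      ha s hε hlim).const_mul (a / π)
    have hint (n : ℕ) : ∫ u in Ioi (0 : ℝ), Real.exp (-ε n * (2 * u + s)) *
        (fouKernel H a u * fouKernel H a (u + s)) =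
        a / π * ∫ x in Ioi (0 : ℝ), Real.cos (a * s * x) *
          ((ε n ^ 2 + (a * x) ^ 2) ^ (-(H - 1 / 2)) / ((a + ε n) ^ 2 + (a * x) ^ 2)) := by
      rw [← integral_indicator measurableSet_Ioi, ← dampedKernel_mul_eq hs,
        integral_dampedKernel_mul hH hH1 ha (hε n)]
      exact integral_cos_mul_comp_sq ha s
        fun y => (ε n ^ 2 + y) ^ (-(H - 1 / 2)) / ((a + ε n) ^ 2 + y)
    simp only [hint]
    convert h using 2
    rw [← mul_assoc, show -(2 * (H - 1 / 2)) = 1 - 2 * H by ring]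
    congr 1
    rw [show -(2 * H) = 1 + (1 - 2 * H - 2) by ring, Real.rpow_add ha, Real.rpow_one]
    ring
end

section
/- For H ∈ (1/2, 1) and a > 0, the fOU kernel covariance integral exhibits long-range dependence: lim_{s → ∞} s^{2−2H} · ∫₀^∞ K(u)·K(u+s) du = 1/(2·a²·sin(πH)·Γ(2H−1)). (Equivalently, the normalized correlation satisfies C_Y(s) = (a s)^{2H−2}/Γ(2H−1) + o(s^{2H−2}) as s → ∞, so C_Y is not integrable at infinity.) -/
open Real MeasureTheory Set Filter

/-- The real Beta integrand is integrable on `(0, 1)`. -/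
lemma integrableOn_rpow_mul_one_sub_rpow {p q : ℝ} (hp : 0 < p) (hq : 0 < q) :
    IntegrableOn (fun x : ℝ => x ^ (p - 1) * (1 - x) ^ (q - 1)) (Ioo 0 1) := by
  have h := Complex.betaIntegral_convergent (u := p) (v := q) (by simpa) (by simpa)
  rw [intervalIntegrable_iff_integrableOn_Ioo_of_le zero_le_one] at h
  refine (IntegrableOn.congr_fun h.re (fun x hx => ?_) measurableSet_Ioo)
  have h1 : ((x ^ (p - 1) : ℝ) : ℂ) = (x : ℂ) ^ ((p : ℂ) - 1) := by
    rw [Complex.ofReal_cpow hx.1.le]; push_cast; rfl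
  have h2 : (((1 - x) ^ (q - 1) : ℝ) : ℂ) = (1 - (x : ℂ)) ^ ((q : ℂ) - 1) := by
    rw [Complex.ofReal_cpow (by linarith [hx.2])]; push_cast; rfl
  simp only [← h1, ← h2]
  rw [← Complex.ofReal_mul]
  exact Complex.ofReal_re _

/-- The real Beta integral over `(0, 1)`. -/
lemma integral_rpow_mul_one_sub_rpow {p q : ℝ} (hp : 0 < p) (hq : 0 < q) :
    ∫ x in Ioo (0 : ℝ) 1, x ^ (p - 1) * (1 - x) ^ (q - 1) = ProbabilityTheory.beta p q := by
  have hpos := ProbabilityTheory.beta_pos hp hq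
  have h := ProbabilityTheory.lintegral_betaPDF_eq_one hp hq
  rw [ProbabilityTheory.lintegral_betaPDF, ← ENNReal.toReal_eq_one_iff,
    ← integral_eq_lintegral_of_nonneg_ae] at h
  · simp_rw [mul_assoc, integral_const_mul] at h
    field_simp at h
    exact h
  · refine ae_restrict_of_forall_mem measurableSet_Ioo fun x hx => ?_
    have := hx.1
    have : 0 < 1 - x := by linarith [hx.2]
    simp only [Pi.zero_apply]
    positivity
  · exact Measurable.aestronglyMeasurable (by fun_prop)

lemma image_inv_sub_one_Ioo : (fun x : ℝ => x⁻¹ - 1) '' Ioo 0 1 = Ioi 0 := by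
  ext v
  simp only [mem_image, mem_Ioo, mem_Ioi]
  constructor
  · rintro ⟨x, ⟨h0, h1⟩, rfl⟩
    linarith [(one_lt_inv₀ h0).2 h1]
  · intro hv
    exact ⟨(1 + v)⁻¹, ⟨by positivity, inv_lt_one_of_one_lt₀ (by linarith)⟩, by simp⟩

lemma hasDerivWithinAt_inv_sub_one {x : ℝ} (hx : x ∈ Ioo (0 : ℝ) 1) :
    HasDerivWithinAt (fun x : ℝ => x⁻¹ - 1) (-(x ^ 2)⁻¹) (Ioo 0 1) x :=
  ((hasDerivAt_inv hx.1.ne').sub_const 1).hasDerivWithinAt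

lemma injOn_inv_sub_one : InjOn (fun x : ℝ => x⁻¹ - 1) (Ioo 0 1) := by
  intro x _ y _ h
  simpa using h

lemma abs_deriv_smul_beta_prime_integrand {p q x : ℝ} (hx : x ∈ Ioo (0 : ℝ) 1) :
    |-(x ^ 2)⁻¹| • ((x⁻¹ - 1) ^ (q - 1) * (x⁻¹ - 1 + 1) ^ (-(p + q))) =
      x ^ (p - 1) * (1 - x) ^ (q - 1) := by
  have h0 := hx.1
  have h1 : 0 < 1 - x := by linarith [hx.2]
  have e : x⁻¹ - 1 = (1 - x) * x⁻¹ := by field_simp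
  rw [sub_add_cancel, e, mul_rpow h1.le (by positivity), abs_neg, abs_of_pos (by positivity),
    smul_eq_mul, ← rpow_natCast, ← rpow_neg_one, ← rpow_neg_one x, ← rpow_mul h0.le, ← rpow_mul h0.le,
    ← rpow_mul h0.le]
  rw [show p - 1 = (((2 : ℕ) : ℝ) * -1) + ((-1 * (q - 1)) + -1 * -(p + q)) by push_cast; ring,
    rpow_add h0, rpow_add h0]
  ring

/-- The Beta integrand in its form on `(0, ∞)` is integrable. -/
lemma integrableOn_rpow_mul_add_one_rpow {p q : ℝ} (hp : 0 < p) (hq : 0 < q) :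
    IntegrableOn (fun v : ℝ => v ^ (q - 1) * (v + 1) ^ (-(p + q))) (Ioi 0) := by
  rw [← image_inv_sub_one_Ioo, integrableOn_image_iff_integrableOn_abs_deriv_smul
    measurableSet_Ioo (fun x hx => hasDerivWithinAt_inv_sub_one hx) injOn_inv_sub_one]
  exact (integrableOn_rpow_mul_one_sub_rpow hp hq).congr_fun
    (fun x hx => (abs_deriv_smul_beta_prime_integrand hx).symm) measurableSet_Ioo

/-- The Beta integral in its form on `(0, ∞)`. -/
lemma integral_rpow_mul_add_one_rpow {p q : ℝ} (hp : 0 < p) (hq : 0 < q) :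
    ∫ v in Ioi (0 : ℝ), v ^ (q - 1) * (v + 1) ^ (-(p + q)) = ProbabilityTheory.beta p q := by
  rw [← image_inv_sub_one_Ioo, integral_image_eq_integral_abs_deriv_smul
    measurableSet_Ioo (fun x hx => hasDerivWithinAt_inv_sub_one hx) injOn_inv_sub_one,
    ← integral_rpow_mul_one_sub_rpow hp hq]
  exact setIntegral_congr_fun measurableSet_Ioo
    fun x hx => abs_deriv_smul_beta_prime_integrand hx

/-- Autocovariance asymptotics of a kernel comparable to a power: if `K` is bounded by a multiple
of `t ^ (α - 1)` and `t ^ (1 - α) * K t → L`, then `s ^ (1 - 2 * α) * ∫ K(u) K(u + s) du`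
converges to `L ^ 2 * B(1 - 2 α, α)`. -/
lemma tendsto_rpow_mul_integral_mul_shift {K : ℝ → ℝ} {α C L : ℝ} (hα : 0 < α) (hα' : α < 1 / 2)
    (hK : ContinuousOn K (Ioi 0)) (hC : ∀ t, 0 < t → |t ^ (1 - α) * K t| ≤ C)
    (hL : Tendsto (fun t => t ^ (1 - α) * K t) atTop (nhds L)) :
    Tendsto (fun s : ℝ => s ^ (1 - 2 * α) * ∫ u in Ioi (0 : ℝ), K u * K (u + s)) atTop
      (nhds (L ^ 2 * ProbabilityTheory.beta (1 - 2 * α) α)) := by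
  set Q : ℝ → ℝ := fun t => t ^ (1 - α) * K t with hQ
  set w : ℝ → ℝ := fun v => v ^ (α - 1) * (v + 1) ^ (-(1 - 2 * α + α)) with hw
  have hp : 0 < 1 - 2 * α := by linarith
  have hC0 : 0 ≤ C := (abs_nonneg _).trans (hC 1 one_pos)
  have hKQ : ∀ t, 0 < t → K t = t ^ (α - 1) * Q t := fun t ht => by
    rw [hQ]
    simp only
    rw [← mul_assoc, ← rpow_add ht]
    simp
  have hQc : ContinuousOn Q (Ioi 0) :=
    (continuousOn_id.rpow_const fun x hx => Or.inl (ne_of_gt hx)).mul hK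
  have hwc : ContinuousOn w (Ioi 0) :=
    (continuousOn_id.rpow_const fun x hx => Or.inl (ne_of_gt hx)).mul
      ((continuousOn_id.add continuousOn_const).rpow_const fun x hx =>
        Or.inl (by have : (0 : ℝ) < x := hx; exact (add_pos this one_pos).ne'))
  have hscale : ∀ s : ℝ, 0 < s → ∫ v in Ioi (0 : ℝ), w v * (Q (s * v) * Q (s * v + s)) =
      s ^ (1 - 2 * α) * ∫ u in Ioi (0 : ℝ), K u * K (u + s) := by
    intro s hs
    have h := integral_comp_mul_left_Ioi' (fun u => K u * K (u + s)) 0 hs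
    rw [mul_zero] at h
    rw [← h, smul_eq_mul, ← mul_assoc, ← integral_const_mul]
    refine setIntegral_congr_fun measurableSet_Ioi fun v hv => ?_
    have hv : 0 < v := hv
    have e : s * v + s = s * (v + 1) := by ring
    simp only [hw]
    rw [hKQ (s * v) (by positivity), hKQ (s * v + s) (by positivity), e,
      mul_rpow hs.le hv.le, mul_rpow hs.le (by positivity : 0 ≤ v + 1)]
    have h1 : s ^ (1 - 2 * α) * s * (s ^ (α - 1) * s ^ (α - 1)) = 1 := by
      nth_rewrite 2 [← rpow_one s]
      rw [← rpow_add hs, ← rpow_add hs, ← rpow_add hs]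
      ring_nf
      simp
    rw [show -(1 - 2 * α + α) = α - 1 by ring]
    linear_combination (-(v ^ (α - 1) * (v + 1) ^ (α - 1) * Q (s * v) * Q (s * (v + 1)))) * h1
  have hint := integrableOn_rpow_mul_add_one_rpow hp hα
  have hlim : ∫ v in Ioi (0 : ℝ), w v * (L * L) =
      L ^ 2 * ProbabilityTheory.beta (1 - 2 * α) α := by
    rw [integral_mul_const, integral_rpow_mul_add_one_rpow hp hα]
    ring
  rw [← hlim]
  refine Tendsto.congr' ((eventually_gt_atTop 0).mono hscale) ?_
  refine tendsto_integral_filter_of_dominated_convergence (fun v => w v * (C * C)) ?_ ?_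
    (hint.mul_const _) ?_
  · filter_upwards [eventually_gt_atTop 0] with s hs
    refine ContinuousOn.aestronglyMeasurable (hwc.mul (ContinuousOn.mul ?_ ?_)) measurableSet_Ioi
    · exact hQc.comp (by fun_prop) fun v hv => mul_pos hs hv
    · exact hQc.comp (by fun_prop) fun v hv => add_pos (mul_pos hs hv) hs
  · filter_upwards [eventually_gt_atTop 0] with s hs
    refine ae_restrict_of_forall_mem measurableSet_Ioi fun v hv => ?_
    have hv : 0 < v := hv
    have hw0 : 0 ≤ w v := by simp only [hw]; positivity
    rw [norm_eq_abs, abs_mul, abs_of_nonneg hw0, abs_mul]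
    exact mul_le_mul_of_nonneg_left (mul_le_mul (hC _ (by positivity)) (hC _ (by positivity))
      (abs_nonneg _) hC0) hw0
  · refine ae_restrict_of_forall_mem measurableSet_Ioi fun v hv => ?_
    have h1 : Tendsto (fun s : ℝ => s * v) atTop atTop := tendsto_id.atTop_mul_const hv
    exact ((hL.comp h1).mul (hL.comp (h1.atTop_add_atTop tendsto_id))).const_mul _

/-- Closed form of the limiting constant. -/
lemma beta_div_Gamma_sq_eq {H a : ℝ} (hH : 1 / 2 < H) (hH1 : H < 1) :
    (1 / (a * Gamma (H - 1 / 2))) ^ 2 * ProbabilityTheory.beta (1 - 2 * (H - 1 / 2)) (H - 1 / 2) =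
      1 / (2 * a ^ 2 * sin (π * H) * Gamma (2 * H - 1)) := by
  have h1 := Real.Gamma_mul_Gamma_one_sub (H - 1 / 2)
  have h2 := Real.Gamma_mul_Gamma_one_sub (2 * H - 1)
  rw [show π * (H - 1 / 2) = π * H - π / 2 by ring, sin_sub_pi_div_two] at h1
  rw [show π * (2 * H - 1) = 2 * (π * H) - π by ring, sin_sub_pi, sin_two_mul] at h2
  have hs : 0 < sin (π * H) :=
    sin_pos_of_pos_of_lt_pi (by nlinarith [pi_pos]) (by nlinarith [pi_pos])
  have hc : cos (π * H) < 0 :=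
    cos_neg_of_pi_div_two_lt_of_lt (by nlinarith [pi_pos]) (by nlinarith [pi_pos])
  have g1 := Gamma_pos_of_pos (show 0 < H - 1 / 2 by linarith)
  have g2 := Gamma_pos_of_pos (show 0 < 1 - (H - 1 / 2) by linarith)
  have g3 := Gamma_pos_of_pos (show 0 < 2 * H - 1 by linarith)
  have g4 := Gamma_pos_of_pos (show 0 < 1 - (2 * H - 1) by linarith)
  rw [ProbabilityTheory.beta, show 1 - 2 * (H - 1 / 2) + (H - 1 / 2) = 1 - (H - 1 / 2) by ring,
    show 1 - 2 * (H - 1 / 2) = 1 - (2 * H - 1) by ring]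
  set A := Gamma (H - 1 / 2)
  set B := Gamma (1 - (H - 1 / 2))
  set D := Gamma (2 * H - 1)
  set E := Gamma (1 - (2 * H - 1))
  have hE : E = π / -(2 * sin (π * H) * cos (π * H)) / D := by
    rw [← h2]; field_simp
  have hB : B = π / -cos (π * H) / A := by
    rw [← h1]; field_simp
  rw [hE, hB]
  have := hc.ne
  rcases eq_or_ne a 0 with rfl | ha
  · simp
  · field_simp

lemma intervalIntegrable_rpow_mul_exp {α : ℝ} (hα : 0 < α) (a x y : ℝ) :
    IntervalIntegrable (fun r : ℝ => r ^ (α - 1) * exp (a * r)) volume x y :=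
  (intervalIntegral.intervalIntegrable_rpow' (by linarith)).mul_continuousOn (by fun_prop)

/-- Integration by parts puts the kernel in the form of a convolution of a power with
an exponential. -/
lemma fouKernel_eq {H a t : ℝ} (hH : 1 / 2 < H) (ht : 0 < t) :
    fouKernel H a t = 1 / Gamma (H - 1 / 2) *
      (exp (-a * t) * ∫ r in (0 : ℝ)..t, r ^ (H - 1 / 2 - 1) * exp (a * r)) := by
  have hα : 0 < H - 1 / 2 := by linarith
  rw [fouKernel, show H + 1 / 2 = H - 1 / 2 + 1 by ring, Gamma_add_one hα.ne']
  set α := H - 1 / 2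
  have hsub : ∫ s in (0 : ℝ)..t, (t - s) ^ α * exp (-a * s) =
      exp (-a * t) * ∫ r in (0 : ℝ)..t, r ^ α * exp (a * r) := by
    have h := intervalIntegral.integral_comp_sub_left
      (fun r => r ^ α * exp (-a * (t - r))) t (a := 0) (b := t)
    simp only [sub_sub_cancel, sub_self, sub_zero] at h
    rw [h, ← intervalIntegral.integral_const_mul]
    congr 1 with r
    rw [show -a * (t - r) = -a * t + a * r by ring, exp_add]
    ring
  have hparts := intervalIntegral.integral_mul_deriv_eq_deriv_mul_of_hasDerivAt
    (u := fun r : ℝ => r ^ α) (u' := fun r => α * r ^ (α - 1)) (v := fun r => exp (a * r))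
    (v' := fun r => exp (a * r) * a) (a := 0) (b := t)
    (continuousOn_id.rpow_const fun x _ => Or.inr hα.le) (by fun_prop)
    (fun x hx => by
      rw [min_eq_left ht.le] at hx
      exact hasDerivAt_rpow_const (Or.inl hx.1.ne'))
    (fun x _ => by simpa using ((hasDerivAt_id x).const_mul a).exp)
    ((intervalIntegral.intervalIntegrable_rpow' (by linarith)).const_mul α)
    (Continuous.intervalIntegrable (by fun_prop) _ _)
  simp only [← mul_assoc, intervalIntegral.integral_mul_const, zero_rpow hα.ne', zero_mul,
    sub_zero] at hparts
  simp only [mul_assoc, intervalIntegral.integral_const_mul] at hparts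
  have hexp : exp (-a * t) * exp (a * t) = 1 := by rw [← exp_add]; simp
  have hG := (Gamma_pos_of_pos hα).ne'
  rw [hsub]
  field_simp
  simp only [neg_mul] at hexp ⊢
  linear_combination (-exp (-(a * t))) * hparts - t ^ α * hexp

lemma continuousOn_fouKernel {H a : ℝ} (hH : 1 / 2 < H) : ContinuousOn (fouKernel H a) (Ioi 0) := by
  have hc := intervalIntegral.continuous_primitive
    (intervalIntegrable_rpow_mul_exp (α := H - 1 / 2) (by linarith) a) 0
  have : Continuous fun t => 1 / Gamma (H - 1 / 2) *
      (exp (-a * t) * ∫ r in (0 : ℝ)..t, r ^ (H - 1 / 2 - 1) * exp (a * r)) := by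
    fun_prop
  exact this.continuousOn.congr fun t ht => fouKernel_eq hH ht

lemma integral_exp_const_mul {a : ℝ} (ha : a ≠ 0) (x y : ℝ) :
    ∫ r in x..y, exp (a * r) = (exp (a * y) - exp (a * x)) / a := by
  rw [intervalIntegral.integral_comp_mul_left (fun r => exp r) ha, integral_exp, smul_eq_mul]
  ring

lemma le_rpow_mul_exp_mul_integral {α a t : ℝ} (hα : 0 < α) (hα1 : α < 1) (ha : 0 < a)
    (ht : 0 < t) :
    (1 - exp (-a * t)) / a ≤
      t ^ (1 - α) * (exp (-a * t) * ∫ r in (0 : ℝ)..t, r ^ (α - 1) * exp (a * r)) := by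
  have h : t ^ (α - 1) * ((exp (a * t) - 1) / a) ≤
      ∫ r in (0 : ℝ)..t, r ^ (α - 1) * exp (a * r) := by
    have e := integral_exp_const_mul ha.ne' 0 t
    rw [mul_zero, exp_zero] at e
    rw [← e, ← intervalIntegral.integral_const_mul]
    refine intervalIntegral.integral_mono_on_of_le_Ioo ht.le
      (Continuous.intervalIntegrable (by fun_prop) _ _)
      (intervalIntegrable_rpow_mul_exp hα a _ _) fun r hr => ?_
    exact mul_le_mul_of_nonneg_right
      (rpow_le_rpow_of_nonpos hr.1 hr.2.le (by linarith)) (exp_pos _).le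
  have h1 : t ^ (1 - α) * t ^ (α - 1) = 1 := by rw [← rpow_add ht]; simp
  have hexp : exp (-a * t) * exp (a * t) = 1 := by rw [← exp_add]; simp
  calc (1 - exp (-a * t)) / a
      = t ^ (1 - α) * (exp (-a * t) * (t ^ (α - 1) * ((exp (a * t) - 1) / a))) := by
        linear_combination (-(exp (-a * t) * (exp (a * t) - 1) / a)) * h1 - (1 / a) * hexp
    _ ≤ _ := by gcongr

lemma rpow_mul_exp_mul_integral_le {α a t c : ℝ} (hα : 0 < α) (hα1 : α < 1) (ha : 0 < a)
    (ht : 0 < t) (hc : 0 < c) (hc1 : c < 1) :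
    t ^ (1 - α) * (exp (-a * t) * ∫ r in (0 : ℝ)..t, r ^ (α - 1) * exp (a * r)) ≤
      t * exp (-(a * (1 - c)) * t) / α + c ^ (α - 1) / a := by
  have hct : c * t ≤ t := by nlinarith
  have hct0 : 0 < c * t := by positivity
  have hi := intervalIntegrable_rpow_mul_exp hα a
  have h1 : ∫ r in (0 : ℝ)..(c * t), r ^ (α - 1) * exp (a * r) ≤
      t ^ α / α * exp (a * (c * t)) := by
    calc _ ≤ ∫ r in (0 : ℝ)..(c * t), r ^ (α - 1) * exp (a * (c * t)) := by
          refine intervalIntegral.integral_mono_on_of_le_Ioo hct0.le (hi _ _)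
            ((intervalIntegral.intervalIntegrable_rpow' (by linarith)).mul_const _)
            fun r hr => ?_
          have := hr.1
          have := hr.2.le
          gcongr
      _ = (c * t) ^ α / α * exp (a * (c * t)) := by
          rw [intervalIntegral.integral_mul_const, integral_rpow (Or.inl (by linarith))]
          simp [zero_rpow hα.ne']
      _ ≤ _ := by gcongr
  have h2 : ∫ r in (c * t)..t, r ^ (α - 1) * exp (a * r) ≤
      (c * t) ^ (α - 1) * (exp (a * t) / a) := by
    calc _ ≤ ∫ r in (c * t)..t, (c * t) ^ (α - 1) * exp (a * r) := by
          refine intervalIntegral.integral_mono_on_of_le_Ioo hct (hi _ _)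
            (Continuous.intervalIntegrable (by fun_prop) _ _) fun r hr => ?_
          exact mul_le_mul_of_nonneg_right
            (rpow_le_rpow_of_nonpos hct0 hr.1.le (by linarith)) (exp_pos _).le
      _ = (c * t) ^ (α - 1) * ((exp (a * t) - exp (a * (c * t))) / a) := by
          rw [intervalIntegral.integral_const_mul, integral_exp_const_mul ha.ne']
      _ ≤ _ := by
          gcongr
          linarith [exp_pos (a * (c * t))]
  rw [← intervalIntegral.integral_add_adjacent_intervals (hi 0 (c * t)) (hi (c * t) t)]
  rw [mul_rpow hc.le ht.le] at h2
  have e1 : t ^ (1 - α) * t ^ (α - 1) = 1 := by rw [← rpow_add ht]; simp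
  have e2 : t ^ (1 - α) * t ^ α = t := by rw [← rpow_add ht]; simp
  have hexp : exp (-a * t) * exp (a * t) = 1 := by rw [← exp_add]; simp
  have hexp' : exp (-a * t) * exp (a * (c * t)) = exp (-(a * (1 - c)) * t) := by
    rw [← exp_add]; ring_nf
  calc _ ≤ t ^ (1 - α) * (exp (-a * t) * (t ^ α / α * exp (a * (c * t)) +
        c ^ (α - 1) * t ^ (α - 1) * (exp (a * t) / a))) := by gcongr
    _ = (t ^ (1 - α) * t ^ α) * (exp (-a * t) * exp (a * (c * t))) / α +
        c ^ (α - 1) * (t ^ (1 - α) * t ^ (α - 1)) * (exp (-a * t) * exp (a * t)) / a := by ring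
    _ = _ := by rw [e1, e2, hexp, hexp']; ring

lemma tendsto_mul_exp_neg_mul_atTop {b : ℝ} (hb : 0 < b) :
    Tendsto (fun t : ℝ => t * exp (-b * t)) atTop (nhds 0) := by
  simpa using tendsto_rpow_mul_exp_neg_mul_atTop_nhds_zero 1 b hb

lemma tendsto_rpow_mul_exp_mul_integral {α a : ℝ} (hα : 0 < α) (hα1 : α < 1) (ha : 0 < a) :
    Tendsto (fun t : ℝ => t ^ (1 - α) *
      (exp (-a * t) * ∫ r in (0 : ℝ)..t, r ^ (α - 1) * exp (a * r))) atTop (nhds (1 / a)) := by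
  refine tendsto_order.2 ⟨fun b hb => ?_, fun b hb => ?_⟩
  · have h : Tendsto (fun t : ℝ => (1 - exp (-a * t)) / a) atTop (nhds ((1 - 0) / a)) := by
      refine (tendsto_const_nhds.sub (tendsto_exp_atBot.comp ?_)).div_const a
      exact tendsto_id.const_mul_atTop_of_neg (by linarith)
    rw [sub_zero] at h
    filter_upwards [h.eventually_const_lt hb, eventually_gt_atTop 0] with t h1 ht
    exact h1.trans_le (le_rpow_mul_exp_mul_integral hα hα1 ha ht)
  · have hcont : Tendsto (fun c : ℝ => c ^ (α - 1) / a) (nhdsWithin 1 (Iio 1)) (nhds (1 / a)) := by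
      have : ContinuousAt (fun c : ℝ => c ^ (α - 1) / a) 1 :=
        (continuousAt_id.rpow_const (Or.inl one_ne_zero)).div_const a
      simpa [ContinuousAt] using this.tendsto.mono_left nhdsWithin_le_nhds
    obtain ⟨c, hcb, hc0, hc1⟩ := ((hcont.eventually_lt_const hb).and
      (Ioo_mem_nhdsLT (zero_lt_one' ℝ))).exists
    have h : Tendsto (fun t : ℝ => t * exp (-(a * (1 - c)) * t) / α + c ^ (α - 1) / a) atTop
        (nhds (0 / α + c ^ (α - 1) / a)) :=
      ((tendsto_mul_exp_neg_mul_atTop (mul_pos ha (by linarith))).div_const α).add_const _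
    rw [zero_div, zero_add] at h
    filter_upwards [h.eventually_lt_const hcb, eventually_gt_atTop 0] with t h1 ht
    exact (rpow_mul_exp_mul_integral_le hα hα1 ha ht hc0 hc1).trans_lt h1

lemma exists_abs_rpow_mul_exp_mul_integral_le {α a : ℝ} (hα : 0 < α) (hα1 : α < 1) (ha : 0 < a) :
    ∃ C, ∀ t : ℝ, 0 < t → |t ^ (1 - α) *
      (exp (-a * t) * ∫ r in (0 : ℝ)..t, r ^ (α - 1) * exp (a * r))| ≤ C := by
  refine ⟨2 / a / α + (1 / 2) ^ (α - 1) / a, fun t ht => ?_⟩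
  have hlow := le_rpow_mul_exp_mul_integral hα hα1 ha ht
  have h0 : 0 ≤ (1 - exp (-a * t)) / a :=
    div_nonneg (by linarith [exp_le_one_iff.2 (by nlinarith : -a * t ≤ 0)]) ha.le
  rw [abs_of_nonneg (h0.trans hlow)]
  refine (rpow_mul_exp_mul_integral_le hα hα1 ha ht (c := 1 / 2) (by norm_num)
    (by norm_num)).trans ?_
  have : t * exp (-(a * (1 - 1 / 2)) * t) ≤ 2 / a := by
    have h1 := add_one_le_exp (a * (1 - 1 / 2) * t)
    rw [neg_mul, exp_neg, ← div_eq_mul_inv, div_le_div_iff₀ (exp_pos _) ha]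
    linarith
  gcongr

/-- For `H ∈ (1/2,1)` and `a > 0`, long-range dependence of the fOU kernel covariance:
`lim_{s → ∞} s^{2−2H} ∫₀^∞ K(u)K(u+s) du = 1/(2 a² sin(πH) Γ(2H−1))`. -/
theorem fouKernel_covariance_long_range (H a : ℝ) (hH : 1 / 2 < H) (hH1 : H < 1) (ha : 0 < a) :
    Tendsto
      (fun s : ℝ => s ^ (2 - 2 * H) *
        ∫ u in Set.Ioi (0 : ℝ), fouKernel H a u * fouKernel H a (u + s))
      atTop
      (nhds (1 / (2 * a ^ 2 * Real.sin (Real.pi * H) * Real.Gamma (2 * H - 1)))) := by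
  have hα : 0 < H - 1 / 2 := by linarith
  have hα1 : H - 1 / 2 < 1 := by linarith
  have hG := Gamma_pos_of_pos hα
  have hK : ∀ t, 0 < t → 1 / Gamma (H - 1 / 2) * (t ^ (1 - (H - 1 / 2)) *
      (exp (-a * t) * ∫ r in (0 : ℝ)..t, r ^ (H - 1 / 2 - 1) * exp (a * r))) =
      t ^ (1 - (H - 1 / 2)) * fouKernel H a t := fun t ht => by
    rw [fouKernel_eq hH ht]; ring
  obtain ⟨C, hC⟩ := exists_abs_rpow_mul_exp_mul_integral_le hα hα1 ha
  have hbound : ∀ t, 0 < t →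
      |t ^ (1 - (H - 1 / 2)) * fouKernel H a t| ≤ 1 / Gamma (H - 1 / 2) * C := fun t ht => by
    rw [← hK t ht, abs_mul, abs_of_pos (by positivity : 0 < 1 / Gamma (H - 1 / 2))]
    have := hC t ht
    gcongr
  have hlim : Tendsto (fun t => t ^ (1 - (H - 1 / 2)) * fouKernel H a t) atTop
      (nhds (1 / (a * Gamma (H - 1 / 2)))) := by
    have h := (tendsto_rpow_mul_exp_mul_integral hα hα1 ha).const_mul (1 / Gamma (H - 1 / 2))
    rw [show 1 / Gamma (H - 1 / 2) * (1 / a) = 1 / (a * Gamma (H - 1 / 2)) by field_simp] at h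
    exact h.congr' ((eventually_gt_atTop 0).mono hK)
  have h := tendsto_rpow_mul_integral_mul_shift hα (by linarith) (continuousOn_fouKernel hH)
    hbound hlim
  rwa [beta_div_Gamma_sq_eq hH hH1, show 1 - 2 * (H - 1 / 2) = 2 - 2 * H by ring] at h
end

section
/- For H ∈ (1/2, 1), a > 0 and T > 0, the iterated integral of the ε-scaled fOU kernel satisfies lim_{ε → 0⁺} ε^{H−1} · ∫₀^T ∫₀^s ε^{−1/2}·K((s−u)/ε) du ds = T^{H+1/2}/(a·Γ(H+3/2)). -/
open Real MeasureTheory Set Filter Topology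

/-- The convolution of `r ↦ r ^ p` with the exponential kernel `r ↦ exp (-a * r)`. -/
noncomputable def rpowExpConv (p a t : ℝ) : ℝ :=
  Real.exp (-a * t) * ∫ r in (0 : ℝ)..t, r ^ p * Real.exp (a * r)

theorem continuous_rpow_mul_exp {p : ℝ} (hp : 0 ≤ p) (a : ℝ) :
    Continuous fun r : ℝ => r ^ p * Real.exp (a * r) :=
  (Real.continuous_rpow_const hp).mul (by fun_prop)

theorem integral_rpow_mul_exp_eq (p a t : ℝ) :
    ∫ s in (0 : ℝ)..t, (t - s) ^ p * Real.exp (-a * s) = rpowExpConv p a t := by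
  have h := intervalIntegral.integral_comp_sub_left (a := 0) (b := t)
    (fun r : ℝ => r ^ p * Real.exp (-a * (t - r))) t
  simp only [sub_sub_cancel, sub_self, sub_zero] at h
  rw [h, rpowExpConv, ← intervalIntegral.integral_const_mul]
  refine intervalIntegral.integral_congr fun r _ => ?_
  rw [mul_left_comm, ← Real.exp_add]
  ring_nf

theorem rpowExpConv_zero (p a : ℝ) : rpowExpConv p a 0 = 0 := by
  simp [rpowExpConv]

theorem hasDerivAt_rpowExpConv {p : ℝ} (hp : 0 ≤ p) (a t : ℝ) :
    HasDerivAt (rpowExpConv p a) (t ^ p - a * rpowExpConv p a t) t := by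
  have h1 : HasDerivAt (fun x : ℝ => Real.exp (-a * x)) (Real.exp (-a * t) * (-a)) t := by
    simpa using ((hasDerivAt_id t).const_mul (-a)).exp
  have h2 := (continuous_rpow_mul_exp hp a).integral_hasStrictDerivAt 0 t |>.hasDerivAt
  refine (h1.mul h2).congr_deriv ?_
  have h3 : Real.exp (-a * t) * Real.exp (a * t) = 1 := by
    rw [← Real.exp_add]; simp
  rw [rpowExpConv]
  linear_combination t ^ p * h3

theorem continuous_rpowExpConv {p : ℝ} (hp : 0 ≤ p) (a : ℝ) : Continuous (rpowExpConv p a) :=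
  continuous_iff_continuousAt.2 fun t => (hasDerivAt_rpowExpConv hp a t).continuousAt

theorem rpowExpConv_nonneg (p a : ℝ) {t : ℝ} (ht : 0 ≤ t) : 0 ≤ rpowExpConv p a t :=
  mul_nonneg (Real.exp_pos _).le <| intervalIntegral.integral_nonneg ht fun _ hr =>
    mul_nonneg (Real.rpow_nonneg hr.1 _) (Real.exp_pos _).le

theorem rpowExpConv_le {p a t : ℝ} (hp : 0 ≤ p) (ha : 0 < a) (ht : 0 ≤ t) :
    rpowExpConv p a t ≤ t ^ p / a := by
  have h1 : ∫ r in (0 : ℝ)..t, r ^ p * Real.exp (a * r) ≤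
      ∫ r in (0 : ℝ)..t, t ^ p * Real.exp (a * r) := by
    refine intervalIntegral.integral_mono_on ht
      ((continuous_rpow_mul_exp hp a).intervalIntegrable _ _)
      (Continuous.intervalIntegrable (by fun_prop) _ _) fun r hr => ?_
    exact mul_le_mul_of_nonneg_right (Real.rpow_le_rpow hr.1 hr.2 hp) (Real.exp_pos _).le
  have h2 : ∫ r in (0 : ℝ)..t, Real.exp (a * r) = (Real.exp (a * t) - 1) / a := by
    rw [intervalIntegral.integral_comp_mul_left (fun x => Real.exp x) ha.ne', integral_exp]
    simp [div_eq_inv_mul]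
  rw [intervalIntegral.integral_const_mul, h2] at h1
  have h3 : Real.exp (-a * t) * Real.exp (a * t) = 1 := by
    rw [← Real.exp_add]; simp
  calc rpowExpConv p a t
      ≤ Real.exp (-a * t) * (t ^ p * ((Real.exp (a * t) - 1) / a)) :=
        mul_le_mul_of_nonneg_left h1 (Real.exp_pos _).le
    _ = t ^ p / a * (1 - Real.exp (-a * t)) := by linear_combination t ^ p / a * h3
    _ ≤ t ^ p / a * 1 := by
        have := Real.exp_pos (-a * t)
        have := Real.rpow_nonneg ht p
        gcongr
        linarith
    _ = t ^ p / a := mul_one _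

theorem fouKernel_eq_rpowExpConv (H a t : ℝ) :
    fouKernel H a t = 1 / Real.Gamma (H + 1 / 2) *
      (t ^ (H - 1 / 2) - a * rpowExpConv (H - 1 / 2) a t) := by
  rw [fouKernel, integral_rpow_mul_exp_eq]

theorem integral_fouKernel {H : ℝ} (hH : 1 / 2 ≤ H) (a t : ℝ) :
    ∫ x in (0 : ℝ)..t, fouKernel H a x =
      1 / Real.Gamma (H + 1 / 2) * rpowExpConv (H - 1 / 2) a t := by
  have hp : 0 ≤ H - 1 / 2 := by linarith
  simp only [fouKernel_eq_rpowExpConv]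
  rw [intervalIntegral.integral_const_mul,
    intervalIntegral.integral_eq_sub_of_hasDerivAt
      (fun x _ => hasDerivAt_rpowExpConv hp a x)
      (((Real.continuous_rpow_const hp).sub
        (continuous_const.mul (continuous_rpowExpConv hp a))).intervalIntegrable _ _),
    rpowExpConv_zero, sub_zero]

theorem integral_rpowExpConv {p a : ℝ} (hp : 0 ≤ p) (ha : a ≠ 0) (t : ℝ) :
    ∫ x in (0 : ℝ)..t, rpowExpConv p a x =
      (t ^ (p + 1) / (p + 1) - rpowExpConv p a t) / a := by
  have h1 : p + 1 ≠ 0 := by linarith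
  rw [intervalIntegral.integral_eq_sub_of_hasDerivAt
      (f := fun x => (x ^ (p + 1) / (p + 1) - rpowExpConv p a x) / a) (fun x _ => ?_)
      ((continuous_rpowExpConv hp a).intervalIntegrable _ _)]
  · simp [rpowExpConv_zero, Real.zero_rpow h1]
  · have h2 := (Real.hasDerivAt_rpow_const (x := x) (p := p + 1)
      (Or.inr (by linarith))).div_const (p + 1)
    refine ((h2.sub (hasDerivAt_rpowExpConv hp a x)).div_const a).congr_deriv ?_
    rw [add_sub_cancel_right]
    field_simp
    ring

theorem iterated_integral_scaled_fouKernel {H a ε : ℝ} (hH : 1 / 2 ≤ H) (ha : a ≠ 0)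
    (hε : 0 < ε) (T : ℝ) :
    ∫ s in (0 : ℝ)..T, ∫ u in (0 : ℝ)..s, ε ^ (-(1 / 2) : ℝ) * fouKernel H a ((s - u) / ε) =
      ε ^ (-(1 / 2) : ℝ) * ε ^ 2 * (1 / Real.Gamma (H + 1 / 2)) *
        (((T / ε) ^ (H + 1 / 2) / (H + 1 / 2) - rpowExpConv (H - 1 / 2) a (T / ε)) / a) := by
  have hp : 0 ≤ H - 1 / 2 := by linarith
  have inner (s : ℝ) :
      ∫ u in (0 : ℝ)..s, ε ^ (-(1 / 2) : ℝ) * fouKernel H a ((s - u) / ε) =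
        ε ^ (-(1 / 2) : ℝ) * ε * (1 / Real.Gamma (H + 1 / 2)) *
          rpowExpConv (H - 1 / 2) a (s / ε) := by
    rw [intervalIntegral.integral_const_mul,
      intervalIntegral.integral_comp_sub_left (fun x => fouKernel H a (x / ε)),
      intervalIntegral.integral_comp_div _ hε.ne', sub_self, sub_zero, zero_div,
      integral_fouKernel hH, smul_eq_mul]
    ring
  simp only [inner]
  rw [intervalIntegral.integral_const_mul,
    intervalIntegral.integral_comp_div _ hε.ne', zero_div,
    integral_rpowExpConv hp ha, smul_eq_mul, show H - 1 / 2 + 1 = H + 1 / 2 by ring]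
  ring

/-- For `H ∈ (1/2,1)`, `a > 0`, `T > 0`, the iterated integral of the ε-scaled fOU kernel
satisfies `lim_{ε → 0⁺} ε^{H−1} ∫₀^T ∫₀^s ε^{−1/2} K((s−u)/ε) du ds
= T^{H+1/2}/(a Γ(H+3/2))`. -/
theorem scaled_fouKernel_iterated_integral_order (H a T : ℝ)
    (hH : 1 / 2 < H) (hH1 : H < 1) (ha : 0 < a) (hT : 0 < T) :
    Tendsto
      (fun ε : ℝ => ε ^ (H - 1) *
        ∫ s in (0 : ℝ)..T, ∫ u in (0 : ℝ)..s, ε ^ (-(1 / 2) : ℝ) * fouKernel H a ((s - u) / ε))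
      (𝓝[>] (0 : ℝ))
      (𝓝 (T ^ (H + 1 / 2) / (a * Real.Gamma (H + 3 / 2)))) := by
  have hp : 0 ≤ H - 1 / 2 := by linarith
  have hq : 0 < H + 1 / 2 := by linarith
  have hG : Real.Gamma (H + 3 / 2) = (H + 1 / 2) * Real.Gamma (H + 1 / 2) := by
    rw [← Real.Gamma_add_one hq.ne']; ring_nf
  have hG0 := (Real.Gamma_pos_of_pos hq).ne'
  have hrem : Tendsto (fun ε : ℝ => ε ^ (H + 1 / 2) * rpowExpConv (H - 1 / 2) a (T / ε))
      (𝓝[>] (0 : ℝ)) (𝓝 0) := by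
    have hlim : Tendsto (fun ε : ℝ => ε * (T ^ (H - 1 / 2) / a)) (𝓝[>] (0 : ℝ)) (𝓝 0) := by
      have : Continuous fun ε : ℝ => ε * (T ^ (H - 1 / 2) / a) := by fun_prop
      simpa using (this.tendsto 0).mono_left nhdsWithin_le_nhds
    refine squeeze_zero' ?_ ?_ hlim
    · filter_upwards [self_mem_nhdsWithin] with ε (hε : 0 < ε)
      exact mul_nonneg (Real.rpow_nonneg hε.le _) (rpowExpConv_nonneg _ _ (by positivity))
    · filter_upwards [self_mem_nhdsWithin] with ε (hε : 0 < ε)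
      have hpow : ε ^ (H + 1 / 2) = ε * ε ^ (H - 1 / 2) := by
        rw [← Real.rpow_one_add' hε.le (by linarith)]; ring_nf
      calc ε ^ (H + 1 / 2) * rpowExpConv (H - 1 / 2) a (T / ε)
          ≤ ε ^ (H + 1 / 2) * ((T / ε) ^ (H - 1 / 2) / a) :=
            mul_le_mul_of_nonneg_left (rpowExpConv_le hp ha (by positivity)) (by positivity)
        _ = ε * (T ^ (H - 1 / 2) / a) := by
            have := (Real.rpow_pos_of_pos hε (H - 1 / 2)).ne'
            rw [hpow, Real.div_rpow hT.le hε.le]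
            field_simp
  have hmain := (hrem.const_mul (1 / (a * Real.Gamma (H + 1 / 2)))).const_sub
    (T ^ (H + 1 / 2) / (a * Real.Gamma (H + 3 / 2)))
  rw [mul_zero, sub_zero] at hmain
  refine hmain.congr' ?_
  filter_upwards [self_mem_nhdsWithin] with ε (hε : 0 < ε)
  have hpow : ε ^ (H - 1) * (ε ^ (-(1 / 2) : ℝ) * ε ^ 2) = ε ^ (H + 1 / 2) := by
    rw [← Real.rpow_natCast ε 2, ← Real.rpow_add hε, ← Real.rpow_add hε]
    push_cast
    ring_nf
  have hne := (Real.rpow_pos_of_pos hε (H + 1 / 2)).ne'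
  rw [iterated_integral_scaled_fouKernel hH.le ha.ne' hε, mul_assoc (_ * _) (1 / _) _,
    ← mul_assoc (ε ^ (H - 1)), hpow, hG, Real.div_rpow hT.le hε.le]
  have hq0 := hq.ne'
  generalize ε ^ (H + 1 / 2) = x at *
  generalize T ^ (H + 1 / 2) = y at *
  generalize Real.Gamma (H + 1 / 2) = z at *
  generalize H + 1 / 2 = w at *
  field_simp
end

section
/- For every H ∈ [1/2, 1), the Gamma-function inequality Γ(2H+1)·sin(πH) ≤ 2H·Γ(H+1/2)² holds; equivalently, the asymptotic variance σ_φ² = σ_ou²·⟨λλ'⟩²·(1/(Γ(2H+1)·sin(πH)) − 1/(2H·Γ(H+1/2)²)) appearing in the Gaussian limit of the martingale component φ_t^ε is nonnegative, with equality in the inequality exactly at H = 1/2. -/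
open Real

/-- The log-convexity of `Γ` at the points `2 - 2H < 3/2 - H, 1 < H + 1/2`, with an explicit factor
that makes the inequality strict for `H ≠ 1/2`. -/
lemma Gamma_three_halves_sub_le {H : ℝ} (h1 : 1 / 2 ≤ H) (h2 : H < 1) :
    (3 / 2 - H) * Gamma (3 / 2 - H) ≤
      ((2 - 2 * H) * (H + 1 / 2)) * (Gamma (2 - 2 * H) * Gamma (H + 1 / 2)) := by
  have hs : (0 : ℝ) < 3 - 2 * H := by linarith
  have ht : 0 < H + 3 / 2 := by linarith
  have h13 := Gamma_mul_add_mul_le_rpow_Gamma_mul_rpow_Gamma hs ht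
    (a := 1 / 3) (b := 2 / 3) (by norm_num) (by norm_num) (by norm_num)
  have h23 := Gamma_mul_add_mul_le_rpow_Gamma_mul_rpow_Gamma hs ht
    (a := 2 / 3) (b := 1 / 3) (by norm_num) (by norm_num) (by norm_num)
  rw [show 1 / 3 * (3 - 2 * H) + 2 / 3 * (H + 3 / 2) = 2 by ring, Gamma_two] at h13
  rw [show 2 / 3 * (3 - 2 * H) + 1 / 3 * (H + 3 / 2) = 3 / 2 - H + 1 by ring] at h23
  have hG := Gamma_pos_of_pos hs
  have hG' := Gamma_pos_of_pos ht
  have hmul := mul_le_mul h13 h23 (Gamma_pos_of_pos (by linarith)).le (by positivity)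
  have hsplit {x : ℝ} (hx : 0 < x) : x ^ (1 / 3 : ℝ) * x ^ (2 / 3 : ℝ) = x := by
    rw [← rpow_add hx]; norm_num
  have hrhs : Gamma (3 - 2 * H) ^ (1 / 3 : ℝ) * Gamma (H + 3 / 2) ^ (2 / 3 : ℝ) *
      (Gamma (3 - 2 * H) ^ (2 / 3 : ℝ) * Gamma (H + 3 / 2) ^ (1 / 3 : ℝ)) =
      Gamma (3 - 2 * H) * Gamma (H + 3 / 2) := by
    rw [mul_mul_mul_comm, hsplit hG, mul_comm (Gamma (H + 3 / 2) ^ (2 / 3 : ℝ)), hsplit hG']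
  rw [hrhs, one_mul, Gamma_add_one (by linarith), show 3 - 2 * H = 2 - 2 * H + 1 by ring,
    Gamma_add_one (by linarith), show H + 3 / 2 = H + 1 / 2 + 1 by ring,
    Gamma_add_one (by linarith)] at hmul
  linarith

/-- The reflection and duplication formulas combined. -/
lemma Gamma_two_mul_mul_sin_mul_Gamma {H : ℝ} (h0 : 0 < H) (h1 : H < 1) :
    Gamma (2 * H) * sin (π * H) * Gamma (2 - 2 * H) = Gamma (H + 1 / 2) * Gamma (3 / 2 - H) := by
  have hx := Gamma_pos_of_pos h0
  have hu := Gamma_pos_of_pos (sub_pos.2 h1)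
  have hsin : 0 < sin (π * H) :=
    sin_pos_of_pos_of_lt_pi (by positivity) (by nlinarith [pi_pos])
  have hrefl := Gamma_mul_Gamma_one_sub H
  have hdup := Gamma_mul_Gamma_add_half H
  have hdup' := Gamma_mul_Gamma_add_half (1 - H)
  rw [show 1 - H + 1 / 2 = 3 / 2 - H by ring, show 2 * (1 - H) = 2 - 2 * H by ring,
    show 1 - (2 - 2 * H) = -(1 - 2 * H) by ring, rpow_neg zero_le_two] at hdup'
  rw [eq_div_iff hsin.ne'] at hrefl
  have hc : (0 : ℝ) < 2 ^ (1 - 2 * H) := by positivity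
  have hprod : Gamma H * Gamma (1 - H) * (Gamma (H + 1 / 2) * Gamma (3 / 2 - H)) =
      Gamma (2 * H) * Gamma (2 - 2 * H) * π := by
    calc _ = (Gamma H * Gamma (H + 1 / 2)) * (Gamma (1 - H) * Gamma (3 / 2 - H)) := by ring
      _ = Gamma (2 * H) * Gamma (2 - 2 * H) * (√π * √π) *
          (2 ^ (1 - 2 * H) * (2 ^ (1 - 2 * H))⁻¹) := by rw [hdup, hdup']; ring
      _ = _ := by rw [mul_inv_cancel₀ hc.ne', mul_self_sqrt pi_pos.le, mul_one]
  refine mul_left_cancel₀ (mul_pos hx hu).ne' ?_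
  rw [hprod]
  linear_combination Gamma (2 * H) * Gamma (2 - 2 * H) * hrefl

/-- For every `H ∈ [1/2,1)`, the Gamma-function inequality
`Γ(2H+1) sin(πH) ≤ 2H Γ(H+1/2)²` holds, with equality exactly at `H = 1/2`
(nonnegativity of the asymptotic variance `σ_φ²`). -/
theorem gamma_sin_le_two_mul_gamma_sq :
    ∀ H ∈ Set.Ico (1 / 2 : ℝ) 1,
      Real.Gamma (2 * H + 1) * Real.sin (Real.pi * H) ≤
          2 * H * (Real.Gamma (H + 1 / 2)) ^ 2 ∧
        (Real.Gamma (2 * H + 1) * Real.sin (Real.pi * H) =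
            2 * H * (Real.Gamma (H + 1 / 2)) ^ 2 ↔ H = 1 / 2) := by
  rintro H ⟨h1, h2⟩
  rcases h1.eq_or_lt with rfl | h1
  · rw [show (2 : ℝ) * (1 / 2) + 1 = 2 by norm_num, show (1 / 2 : ℝ) + 1 / 2 = 1 by norm_num,
      show π * (1 / 2) = π / 2 by ring]
    simp
  have hp : 0 < Gamma (2 - 2 * H) := Gamma_pos_of_pos (by linarith)
  have hy : 0 < Gamma (H + 1 / 2) := Gamma_pos_of_pos (by linarith)
  have hlt : Gamma (3 / 2 - H) < Gamma (2 - 2 * H) * Gamma (H + 1 / 2) := by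
    have hpy := mul_pos hp hy
    have hfac : (2 - 2 * H) * (H + 1 / 2) < 3 / 2 - H := by
      nlinarith [mul_pos (sub_pos.2 h1) (sub_pos.2 h1)]
    exact lt_of_mul_lt_mul_left ((Gamma_three_halves_sub_le h1.le h2).trans_lt
      (mul_lt_mul_of_pos_right hfac hpy)) (by linarith)
  have hmain : Gamma (2 * H) * sin (π * H) < Gamma (H + 1 / 2) ^ 2 := by
    refine lt_of_mul_lt_mul_right ?_ hp.le
    rw [Gamma_two_mul_mul_sin_mul_Gamma (by linarith) h2]
    calc _ < Gamma (H + 1 / 2) * (Gamma (2 - 2 * H) * Gamma (H + 1 / 2)) :=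
          mul_lt_mul_of_pos_left hlt hy
      _ = _ := by ring
  have hgoal : Gamma (2 * H + 1) * sin (π * H) < 2 * H * Gamma (H + 1 / 2) ^ 2 := by
    rw [Gamma_add_one (by linarith), mul_assoc]
    exact mul_lt_mul_of_pos_left hmain (by linarith)
  exact ⟨hgoal.le, fun h => absurd h hgoal.ne, fun h => absurd h h1.ne'⟩
end
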